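/- For every measurable set A ⊆ ℝ with m(A) < ∞ and every λ > 0, the Lebesgue measure of the set {x ∈ A : |H(χ_A)(x)| > λ} equals 2·m(A)/(e^{πλ} + 1). -/

import Mathlib

open MeasureTheory Filter Set
open scoped Classical

/-- The Hilbert transform on `ℝ` of the indicator `χ_A` of a finite-measure set:
`(H χ_A)(t) = lim_{ε→0⁺} (1/π) ∫_{|x-t|>ε} χ_A(x)/(x-t) dx`,
defined to be `0` at points where the limit does not exist. -/
noncomputable def hilbertIndicator (A : Set ℝ) (t : ℝ) : ℂ :=
  if h : ∃ L : ℂ, Tendsto (fun ε : ℝ =>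
      (Real.pi : ℂ)⁻¹ *
        ∫ x in {x : ℝ | ε < |x - t|}, A.indicator (fun _ => (1 : ℂ)) x / ((x : ℂ) - (t : ℂ)))
      (nhdsWithin 0 (Set.Ioi 0)) (nhds L)
  then h.choose else 0

open scoped Topology ENNReal

lemma poisson_eq_scaled {y : ℝ} (hy : 0 < y) (x t : ℝ) :
    y / ((t - x) ^ 2 + y ^ 2) = y⁻¹ * (1 + ((t - x) / y) ^ 2)⁻¹ := by
  field_simp
  ring

lemma integrable_poisson {y : ℝ} (hy : 0 < y) (x : ℝ) :
    Integrable (fun t : ℝ => y / ((t - x) ^ 2 + y ^ 2)) := by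
  simp_rw [poisson_eq_scaled hy x]
  exact (((integrable_inv_one_add_sq.comp_div hy.ne').comp_sub_right x)).const_mul _

lemma integral_poisson {y : ℝ} (hy : 0 < y) (x : ℝ) :
    ∫ t : ℝ, y / ((t - x) ^ 2 + y ^ 2) = Real.pi := by
  simp_rw [poisson_eq_scaled hy x]
  rw [integral_const_mul, integral_sub_right_eq_self (fun t : ℝ => (1 + (t / y) ^ 2)⁻¹),
    Measure.integral_comp_div (fun t : ℝ => (1 + t ^ 2)⁻¹), integral_univ_inv_one_add_sq,
    abs_of_pos hy, smul_eq_mul, inv_mul_cancel_left₀ hy.ne']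

lemma continuous_poisson {y : ℝ} (hy : 0 < y) (x : ℝ) :
    Continuous (fun t : ℝ => y / ((t - x) ^ 2 + y ^ 2)) :=
  Continuous.div (by fun_prop) (by fun_prop) fun t => by positivity

lemma poisson_le_inv {y : ℝ} (hy : 0 < y) (x t : ℝ) : y / ((t - x) ^ 2 + y ^ 2) ≤ y⁻¹ := by
  rw [div_le_iff₀ (by positivity), inv_mul_eq_div, le_div_iff₀ hy]
  nlinarith [sq_nonneg (t - x)]

/-- The Poisson kernel lies in `L²`. -/
lemma memLp_poisson {y : ℝ} (hy : 0 < y) (x : ℝ) :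
    MemLp (fun t : ℝ => y / ((t - x) ^ 2 + y ^ 2)) 2 := by
  rw [memLp_two_iff_integrable_sq (continuous_poisson hy x).aestronglyMeasurable]
  refine ((integrable_poisson hy x).const_mul y⁻¹).mono'
    ((continuous_poisson hy x).pow 2).aestronglyMeasurable (ae_of_all _ fun t => ?_)
  have h0 : 0 ≤ y / ((t - x) ^ 2 + y ^ 2) := by positivity
  rw [Real.norm_of_nonneg (by positivity), sq]
  exact mul_le_mul_of_nonneg_right (poisson_le_inv hy x t) h0

/-- Dyadic majorization of the Poisson kernel by indicators of concentric intervals. -/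
lemma poisson_le_tsum_dyadic {y : ℝ} (hy : 0 < y) (x t : ℝ) :
    ENNReal.ofReal (y / ((t - x) ^ 2 + y ^ 2)) ≤
      ∑' k : ℕ, (Metric.closedBall x (2 ^ k * y)).indicator
        (fun _ => ENNReal.ofReal (4 * (1 / 4) ^ k * y⁻¹)) t := by
  have hex : ∃ k : ℕ, |t - x| ≤ 2 ^ k * y := by
    obtain ⟨k, hk⟩ := pow_unbounded_of_one_lt (|t - x| / y) (one_lt_two)
    exact ⟨k, ((div_lt_iff₀ hy).1 hk).le⟩
  refine le_trans ?_ (ENNReal.le_tsum (Nat.find hex))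
  have hk := Nat.find_spec hex
  rw [indicator_of_mem (by simpa [Real.dist_eq] using hk)]
  apply ENNReal.ofReal_le_ofReal
  rcases Nat.eq_zero_or_pos (Nat.find hex) with h0 | hpos
  · rw [h0]
    have := poisson_le_inv hy x t
    have : 0 < y⁻¹ := by positivity
    norm_num
    linarith
  · obtain ⟨m, hm⟩ := Nat.exists_eq_succ_of_ne_zero hpos.ne'
    have hm' : 2 ^ m * y < |t - x| := by
      have := Nat.find_min hex (m := m) (by omega)
      exact not_le.1 this
    rw [hm, pow_succ (1 / 4 : ℝ) m, div_pow, one_pow]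
    have h4 : ((2 : ℝ) ^ m) ^ 2 = 4 ^ m := by rw [← pow_mul, mul_comm, pow_mul]; norm_num
    have hsq : (4 : ℝ) ^ m * y ^ 2 ≤ (t - x) ^ 2 := by
      rw [← sq_abs (t - x), ← h4, ← mul_pow]
      exact pow_le_pow_left₀ (by positivity) hm'.le 2
    have hp : (0 : ℝ) < 4 ^ m := by positivity
    rw [div_le_iff₀ (by positivity)]
    have : 4 * (1 / 4 ^ m * (1 / 4)) * y⁻¹ * ((t - x) ^ 2 + y ^ 2)
      = ((t - x) ^ 2 + y ^ 2) / (4 ^ m * y) := by field_simp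
    rw [this, le_div_iff₀ (by positivity)]
    nlinarith [sq_nonneg y]

/-- If all averages of `g` over intervals centered at `x` are bounded, so are its Poisson means. -/
lemma lintegral_poisson_mul_le {g : ℝ → ℝ≥0∞} (hg : Measurable g) {x : ℝ} {κ : ℝ≥0∞}
    (hκ : ∀ r : ℝ, 0 < r → ∫⁻ t in Metric.closedBall x r, g t ≤ κ * ENNReal.ofReal r)
    {y : ℝ} (hy : 0 < y) :
    ∫⁻ t, ENNReal.ofReal (y / ((t - x) ^ 2 + y ^ 2)) * g t ≤ 8 * κ := by
  calc ∫⁻ t, ENNReal.ofReal (y / ((t - x) ^ 2 + y ^ 2)) * g t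
      ≤ ∫⁻ t, ∑' k : ℕ, (Metric.closedBall x (2 ^ k * y)).indicator
          (fun t => ENNReal.ofReal (4 * (1 / 4) ^ k * y⁻¹) * g t) t := by
        refine lintegral_mono fun t => ?_
        refine (mul_le_mul_left (poisson_le_tsum_dyadic hy x t) _).trans ?_
        rw [← ENNReal.tsum_mul_right]
        refine ENNReal.tsum_le_tsum fun k => ?_
        by_cases h : t ∈ Metric.closedBall x (2 ^ k * y)
        · simp [indicator_of_mem h]
        · simp [indicator_of_notMem h]
    _ = ∑' k : ℕ, ENNReal.ofReal (4 * (1 / 4) ^ k * y⁻¹) *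
          ∫⁻ t in Metric.closedBall x (2 ^ k * y), g t := by
        rw [lintegral_tsum fun k =>
          ((hg.const_mul _).indicator Metric.isClosed_closedBall.measurableSet).aemeasurable]
        refine tsum_congr fun k => ?_
        rw [lintegral_indicator Metric.isClosed_closedBall.measurableSet,
          lintegral_const_mul _ hg]
    _ ≤ ∑' k : ℕ, ENNReal.ofReal (4 * (1 / 2) ^ k) * κ := by
        refine ENNReal.tsum_le_tsum fun k => ?_
        refine (mul_le_mul_right (hκ _ (by positivity)) _).trans ?_
        rw [mul_left_comm, ← ENNReal.ofReal_mul (by positivity), mul_comm κ]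
        refine mul_le_mul_left (ENNReal.ofReal_le_ofReal (le_of_eq ?_)) _
        have : (1 / 4 : ℝ) ^ k * 2 ^ k = (1 / 2) ^ k := by rw [← mul_pow]; norm_num
        rw [← this]
        field_simp
    _ = 8 * κ := by
        rw [ENNReal.tsum_mul_right, ← ENNReal.ofReal_tsum_of_nonneg (fun k => by positivity)
          (summable_geometric_two.mul_left 4), tsum_mul_left, tsum_geometric_two]
        norm_num

/-- Poisson means of `g` tend to zero at points where its interval averages tend to zero. -/
lemma tendsto_lintegral_poisson_mul {g : ℝ → ℝ≥0∞} (hg : Measurable g) {x : ℝ} {C : ℝ≥0∞}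
    (hC : C ≠ ∞)
    (hgC : ∀ r : ℝ, 0 < r → ∫⁻ t in Metric.closedBall x r, g t ≤ C * ENNReal.ofReal r)
    (h0 : Tendsto (fun r : ℝ => (∫⁻ t in Metric.closedBall x r, g t) / ENNReal.ofReal r)
      (𝓝[>] 0) (𝓝 0)) :
    Tendsto (fun y : ℝ => ∫⁻ t, ENNReal.ofReal (y / ((t - x) ^ 2 + y ^ 2)) * g t)
      (𝓝[>] 0) (𝓝 0) := by
  have key : ∀ κ : ℝ≥0∞, 0 < κ → ∃ D : ℝ≥0∞, D ≠ ∞ ∧ ∀ y : ℝ, 0 < y →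
      ∫⁻ t, ENNReal.ofReal (y / ((t - x) ^ 2 + y ^ 2)) * g t
        ≤ 8 * κ + ENNReal.ofReal y * D := by
    intro κ hκ
    obtain ⟨δ, hδ, hδ'⟩ : ∃ δ : ℝ, 0 < δ ∧ ∀ r : ℝ, 0 < r → r ≤ δ →
        ∫⁻ t in Metric.closedBall x r, g t ≤ κ * ENNReal.ofReal r := by
      have := (h0.eventually (gt_mem_nhds hκ))
      rw [eventually_nhdsWithin_iff, Metric.eventually_nhds_iff] at this
      obtain ⟨δ, hδ, h⟩ := this
      refine ⟨δ / 2, by positivity, fun r hr hrδ => ?_⟩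
      have := (h (y := r) (by rw [Real.dist_eq, sub_zero, abs_of_pos hr]; linarith) hr).le
      rwa [ENNReal.div_le_iff (by simpa using hr) ENNReal.ofReal_ne_top] at this
    set B := Metric.closedBall x δ with hB
    have hBm : MeasurableSet B := Metric.isClosed_closedBall.measurableSet
    refine ⟨ENNReal.ofReal (2 / δ) * (8 * C), by finiteness, fun y hy => ?_⟩
    rw [← lintegral_add_compl _ hBm]
    refine add_le_add ?_ ?_
    · have := lintegral_poisson_mul_le (hg.indicator hBm) (x := x) (κ := κ) (fun r hr => ?_) hy
      · refine le_trans (le_of_eq ?_) this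
        rw [← lintegral_indicator hBm]
        congr 1 with t
        by_cases ht : t ∈ B <;> simp [ht]
      · rw [setLIntegral_indicator hBm]
        rcases le_total r δ with h | h
        · exact (lintegral_mono_set inter_subset_right).trans (hδ' r hr h)
        · refine (lintegral_mono_set inter_subset_left).trans ((hδ' δ hδ le_rfl).trans ?_)
          gcongr
    · have := lintegral_poisson_mul_le hg hgC hδ
      calc ∫⁻ t in Bᶜ, ENNReal.ofReal (y / ((t - x) ^ 2 + y ^ 2)) * g t
          ≤ ∫⁻ t in Bᶜ, ENNReal.ofReal (y * (2 / δ)) *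
              (ENNReal.ofReal (δ / ((t - x) ^ 2 + δ ^ 2)) * g t) := by
            refine setLIntegral_mono' hBm.compl fun t ht => ?_
            rw [← mul_assoc, ← ENNReal.ofReal_mul (by positivity)]
            refine mul_le_mul_left (ENNReal.ofReal_le_ofReal ?_) _
            have ht' : δ ^ 2 < (t - x) ^ 2 := by
              rw [← sq_abs (t - x)]
              have : δ < |t - x| := by simpa [hB, Real.dist_eq] using ht
              exact pow_lt_pow_left₀ this hδ.le (by norm_num)
            have : y * (2 / δ) * (δ / ((t - x) ^ 2 + δ ^ 2))
              = 2 * y / ((t - x) ^ 2 + δ ^ 2) := by field_simp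
            rw [this, div_le_div_iff₀ (by positivity) (by positivity)]
            nlinarith [mul_pos hy (sub_pos.2 ht'), pow_pos hy 3]
        _ ≤ ∫⁻ t, ENNReal.ofReal (y * (2 / δ)) *
              (ENNReal.ofReal (δ / ((t - x) ^ 2 + δ ^ 2)) * g t) := setLIntegral_le_lintegral _ _
        _ ≤ _ := by
            rw [lintegral_const_mul' _ _ ENNReal.ofReal_ne_top, ENNReal.ofReal_mul hy.le, mul_assoc]
            gcongr
  rw [ENNReal.tendsto_nhds_zero]
  intro ε hε
  obtain ⟨κ, hκ, hκε⟩ : ∃ κ : ℝ≥0∞, 0 < κ ∧ 8 * κ ≤ ε / 2 := by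
    refine ⟨ε / 2 / 8, by simp [ENNReal.div_pos_iff, hε.ne'], ?_⟩
    rw [ENNReal.mul_div_cancel (by norm_num) (by norm_num)]
  obtain ⟨D, hD, h⟩ := key κ hκ
  have hlim : Tendsto (fun y : ℝ => ENNReal.ofReal y * D) (𝓝[>] 0) (𝓝 0) := by
    have h1 : Tendsto (fun y : ℝ => ENNReal.ofReal y) (𝓝[>] 0) (𝓝 0) := by
      have := (ENNReal.continuous_ofReal.tendsto 0).mono_left (nhdsWithin_le_nhds (s := Ioi 0))
      simpa using this
    simpa using ENNReal.Tendsto.mul_const h1 (Or.inr hD)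
  have hε2 : 0 < ε / 2 := by simp [hε.ne']
  filter_upwards [self_mem_nhdsWithin, hlim.eventually (gt_mem_nhds hε2)] with y hy hy2
  calc _ ≤ 8 * κ + ENNReal.ofReal y * D := h y hy
    _ ≤ ε / 2 + ε / 2 := add_le_add hκε hy2.le
    _ = ε := ENNReal.add_halves ε

lemma lintegral_enorm_sq_lt_top {f : ℝ → ℂ} (hf : MemLp f 2) : ∫⁻ t, ‖f t‖ₑ ^ 2 < ∞ := by
  have := lintegral_rpow_enorm_lt_top_of_eLpNorm_lt_top (by norm_num) (by norm_num)
    hf.eLpNorm_lt_top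
  simpa using this

/-- Almost everywhere convergence of Poisson means of an `L²` function, in the strong
(Lebesgue point) sense. -/
lemma ae_tendsto_lintegral_poisson {f : ℝ → ℂ} (hfm : Measurable f) (hf : MemLp f 2) :
    ∀ᵐ x : ℝ, Tendsto (fun y : ℝ => ∫⁻ t, ENNReal.ofReal (y / ((t - x) ^ 2 + y ^ 2)) *
      ‖f t - f x‖ₑ) (𝓝[>] 0) (𝓝 0) := by
  have hloc : LocallyIntegrable f := hf.locallyIntegrable (by norm_num)
  have hN := lintegral_enorm_sq_lt_top hf
  filter_upwards [IsUnifLocDoublingMeasure.ae_tendsto_average_norm_sub (μ := volume) hloc 1]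
    with x hx
  have hav := hx (fun _ : ℝ => x) id (l := 𝓝[>] 0) tendsto_id (by
    filter_upwards [self_mem_nhdsWithin] with r hr
    simpa using (le_of_lt hr))
  have hgm : Measurable fun t => ‖f t - f x‖ₑ := (hfm.sub_const _).enorm
  have hlim : Tendsto (fun r : ℝ =>
      (∫⁻ t in Metric.closedBall x r, ‖f t - f x‖ₑ) / ENNReal.ofReal r) (𝓝[>] 0) (𝓝 0) := by
    have h2 := (ENNReal.continuous_ofReal.tendsto _).comp (hav.const_mul 2)
    simp only [mul_zero, ENNReal.ofReal_zero] at h2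
    refine h2.congr' ?_
    filter_upwards [self_mem_nhdsWithin] with r hr
    have hr : 0 < r := hr
    have hInt : IntegrableOn (fun t => f t - f x) (Metric.closedBall x r) := by
      refine (hloc.integrableOn_isCompact (isCompact_closedBall x r)).sub ?_
      exact integrableOn_const (isCompact_closedBall x r).measure_lt_top.ne
    simp only [Function.comp, id]
    rw [← ofReal_integral_norm_eq_lintegral_enorm hInt, ← ENNReal.ofReal_div_of_pos hr]
    congr 1
    rw [setAverage_eq, smul_eq_mul, Real.volume_real_closedBall hr.le]
    field_simp
  obtain ⟨δ, hδ, hδ'⟩ : ∃ δ : ℝ, 0 < δ ∧ ∀ r : ℝ, 0 < r → r < δ →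
      ∫⁻ t in Metric.closedBall x r, ‖f t - f x‖ₑ ≤ ENNReal.ofReal r := by
    have := hlim.eventually (gt_mem_nhds (zero_lt_one))
    rw [eventually_nhdsWithin_iff, Metric.eventually_nhds_iff] at this
    obtain ⟨δ, hδ, h⟩ := this
    refine ⟨δ, hδ, fun r hr hrδ => ?_⟩
    have := (h (y := r) (by rwa [Real.dist_eq, sub_zero, abs_of_pos hr]) hr).le
    rwa [ENNReal.div_le_iff (by simpa using hr) ENNReal.ofReal_ne_top, one_mul] at this
  set N := ∫⁻ t, ‖f t‖ₑ ^ 2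
  refine tendsto_lintegral_poisson_mul hgm
    (C := 1 + (2 * (1 + ‖f x‖ₑ) + N / ENNReal.ofReal δ)) ?_ ?_ hlim
  · have : ENNReal.ofReal δ ≠ 0 := by simpa using hδ
    have := ENNReal.div_ne_top hN.ne this
    finiteness
  · intro r hr
    rcases lt_or_ge r δ with h | h
    · refine (hδ' r hr h).trans ?_
      conv_lhs => rw [← one_mul (ENNReal.ofReal r)]
      gcongr
      exact le_self_add
    · have hpt : ∀ t, ‖f t - f x‖ₑ ≤ (1 + ‖f x‖ₑ) + ‖f t‖ₑ ^ 2 := by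
        intro t
        have h1 : ‖f t‖ₑ ≤ 1 + ‖f t‖ₑ ^ 2 := by
          rcases le_total ‖f t‖ₑ 1 with h | h
          · exact h.trans le_self_add
          · refine le_trans ?_ le_add_self
            rw [sq]
            exact le_mul_of_one_le_left' h
        calc ‖f t - f x‖ₑ ≤ ‖f t‖ₑ + ‖f x‖ₑ := enorm_sub_le
          _ ≤ (1 + ‖f t‖ₑ ^ 2) + ‖f x‖ₑ := by gcongr
          _ = _ := by ring
      calc ∫⁻ t in Metric.closedBall x r, ‖f t - f x‖ₑ
          ≤ ∫⁻ t in Metric.closedBall x r, ((1 + ‖f x‖ₑ) + ‖f t‖ₑ ^ 2) :=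
            lintegral_mono fun t => hpt t
        _ ≤ (1 + ‖f x‖ₑ) * ENNReal.ofReal (2 * r) + N := by
            rw [lintegral_add_left measurable_const, setLIntegral_const, Real.volume_closedBall]
            gcongr
            exact setLIntegral_le_lintegral _ _
        _ ≤ (2 * (1 + ‖f x‖ₑ) + N / ENNReal.ofReal δ) * ENNReal.ofReal r := by
            rw [add_mul (2 * (1 + ‖f x‖ₑ)), ENNReal.ofReal_mul (by norm_num)]
            refine add_le_add (le_of_eq ?_) ?_
            · norm_num; ring
            · calc N = N / ENNReal.ofReal δ * ENNReal.ofReal δ :=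
                    (ENNReal.div_mul_cancel (by simpa using hδ) ENNReal.ofReal_ne_top).symm
                _ ≤ _ := by gcongr
        _ ≤ _ := mul_le_mul_left le_add_self _

/-- The Cauchy transform `∫_A dt / (t - z)` of the indicator of `A`. -/
noncomputable def cauchyTransform (A : Set ℝ) (z : ℂ) : ℂ := ∫ t in A, ((t : ℂ) - z)⁻¹

lemma im_le_norm_ofReal_sub {z : ℂ} (t : ℝ) : z.im ≤ ‖(t : ℂ) - z‖ := by
  have := Complex.abs_im_le_norm ((t : ℂ) - z)
  simp only [Complex.sub_im, Complex.ofReal_im, zero_sub, abs_neg] at this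
  exact (le_abs_self _).trans this

lemma ofReal_sub_ne_zero {z : ℂ} (hz : 0 < z.im) (t : ℝ) : (t : ℂ) - z ≠ 0 :=
  norm_pos_iff.1 (hz.trans_le (im_le_norm_ofReal_sub t))

lemma norm_inv_ofReal_sub_le {z : ℂ} (hz : 0 < z.im) (t : ℝ) :
    ‖((t : ℂ) - z)⁻¹‖ ≤ z.im⁻¹ := by
  rw [norm_inv]
  exact inv_anti₀ hz (im_le_norm_ofReal_sub t)

lemma normSq_ofReal_sub (z : ℂ) (t : ℝ) :
    Complex.normSq ((t : ℂ) - z) = (t - z.re) ^ 2 + z.im ^ 2 := by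
  simp [Complex.normSq_apply]; ring

lemma inv_ofReal_sub_im (z : ℂ) (t : ℝ) :
    (((t : ℂ) - z)⁻¹).im = z.im / ((t - z.re) ^ 2 + z.im ^ 2) := by
  rw [Complex.inv_im, normSq_ofReal_sub]; simp

lemma inv_ofReal_sub_re (z : ℂ) (t : ℝ) :
    (((t : ℂ) - z)⁻¹).re = (t - z.re) / ((t - z.re) ^ 2 + z.im ^ 2) := by
  rw [Complex.inv_re, normSq_ofReal_sub]; simp

lemma norm_inv_ofReal_sub_sq {z : ℂ} (hz : 0 < z.im) (t : ℝ) :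
    ‖((t : ℂ) - z)⁻¹‖ ^ 2 = z.im⁻¹ * (z.im / ((t - z.re) ^ 2 + z.im ^ 2)) := by
  rw [← Complex.normSq_eq_norm_sq, Complex.normSq_inv, normSq_ofReal_sub]
  field_simp

lemma continuous_inv_ofReal_sub {z : ℂ} (hz : 0 < z.im) :
    Continuous fun t : ℝ => ((t : ℂ) - z)⁻¹ :=
  Continuous.inv₀ (by fun_prop) (ofReal_sub_ne_zero hz)

section
variable {A : Set ℝ}

lemma integrableOn_inv_ofReal_sub (hfin : volume A < ⊤) {z : ℂ} (hz : 0 < z.im) :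
    IntegrableOn (fun t : ℝ => ((t : ℂ) - z)⁻¹) A := by
  have : IsFiniteMeasure (volume.restrict A) := ⟨by simpa using hfin⟩
  exact Integrable.of_bound (continuous_inv_ofReal_sub hz).aestronglyMeasurable z.im⁻¹
    (ae_of_all _ (norm_inv_ofReal_sub_le hz))

lemma cauchyTransform_im (hfin : volume A < ⊤) {z : ℂ} (hz : 0 < z.im) :
    (cauchyTransform A z).im = ∫ t in A, z.im / ((t - z.re) ^ 2 + z.im ^ 2) := by
  rw [cauchyTransform, ← Complex.imCLM_apply,
    ← ContinuousLinearMap.integral_comp_comm _ (integrableOn_inv_ofReal_sub hfin hz)]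
  simp only [Complex.imCLM_apply, inv_ofReal_sub_im]

lemma cauchyTransform_re (hfin : volume A < ⊤) {z : ℂ} (hz : 0 < z.im) :
    (cauchyTransform A z).re = ∫ t in A, (t - z.re) / ((t - z.re) ^ 2 + z.im ^ 2) := by
  rw [cauchyTransform, ← Complex.reCLM_apply,
    ← ContinuousLinearMap.integral_comp_comm _ (integrableOn_inv_ofReal_sub hfin hz)]
  simp only [Complex.reCLM_apply, inv_ofReal_sub_re]

lemma cauchyTransform_im_nonneg (hfin : volume A < ⊤) {z : ℂ} (hz : 0 < z.im) :
    0 ≤ (cauchyTransform A z).im := by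
  rw [cauchyTransform_im hfin hz]
  exact integral_nonneg fun t => by positivity

lemma cauchyTransform_im_le_pi (hfin : volume A < ⊤) {z : ℂ} (hz : 0 < z.im) :
    (cauchyTransform A z).im ≤ Real.pi := by
  rw [cauchyTransform_im hfin hz, ← integral_poisson hz z.re]
  exact setIntegral_le_integral (integrable_poisson hz _) (ae_of_all _ fun t => by positivity)

lemma norm_cauchyTransform_le (hfin : volume A < ⊤) {z : ℂ} (hz : 0 < z.im) :
    ‖cauchyTransform A z‖ ≤ volume.real A / z.im := by
  have := norm_setIntegral_le_of_norm_le_const (f := fun t : ℝ => ((t : ℂ) - z)⁻¹) hfin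
    fun t _ => norm_inv_ofReal_sub_le hz t
  rw [div_eq_inv_mul]
  exact this

/-- Cauchy–Schwarz for the Cauchy transform. -/
lemma norm_sq_cauchyTransform_le (hfin : volume A < ⊤) {z : ℂ} (hz : 0 < z.im) :
    ‖cauchyTransform A z‖ ^ 2 ≤ volume.real A / z.im * (cauchyTransform A z).im := by
  have hfm : IsFiniteMeasure (volume.restrict A) := ⟨by simpa using hfin⟩
  have hi := (integrableOn_inv_ofReal_sub hfin hz).norm
  have hP : IntegrableOn (fun t : ℝ => z.im / ((t - z.re) ^ 2 + z.im ^ 2)) A :=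
    (integrable_poisson hz _).integrableOn
  set N := ∫ t in A, ‖((t : ℂ) - z)⁻¹‖ with hN
  have hquad : ∀ m : ℝ, 0 ≤ volume.real A * (m * m) + (-2 * N) * m
      + z.im⁻¹ * (cauchyTransform A z).im := by
    intro m
    have h0 : 0 ≤ ∫ t in A, (‖((t : ℂ) - z)⁻¹‖ - m) ^ 2 := integral_nonneg fun t => sq_nonneg _
    have heq : ∀ t : ℝ, (‖((t : ℂ) - z)⁻¹‖ - m) ^ 2 =
        m * m + (-2 * m) * ‖((t : ℂ) - z)⁻¹‖
          + z.im⁻¹ * (z.im / ((t - z.re) ^ 2 + z.im ^ 2)) := by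
      intro t
      rw [← norm_inv_ofReal_sub_sq hz]; ring
    simp_rw [heq] at h0
    have hc : Integrable (fun t : ℝ => m * m + (-2 * m) * ‖((t : ℂ) - z)⁻¹‖)
      (volume.restrict A) := (integrable_const _).add (hi.const_mul _)
    rw [integral_add hc (hP.const_mul _),
      integral_add (integrable_const _) (hi.const_mul _), integral_const_mul (-2 * m), integral_const_mul z.im⁻¹,
      ← cauchyTransform_im hfin hz, ← hN] at h0
    simp only [integral_const, measureReal_restrict_apply_univ, smul_eq_mul] at h0
    linarith
  have hd := discrim_le_zero hquad
  rw [discrim] at hd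
  have hle : ‖cauchyTransform A z‖ ≤ N := norm_integral_le_integral_norm _
  calc ‖cauchyTransform A z‖ ^ 2 ≤ N ^ 2 := pow_le_pow_left₀ (norm_nonneg _) hle 2
    _ ≤ volume.real A * (z.im⁻¹ * (cauchyTransform A z).im) := by nlinarith
    _ = _ := by ring

lemma differentiableOn_cauchyTransform (hfin : volume A < ⊤) :
    DifferentiableOn ℂ (cauchyTransform A) {z | 0 < z.im} := by
  intro z hz
  have hz : 0 < z.im := hz
  have hfm : IsFiniteMeasure (volume.restrict A) := ⟨by simpa using hfin⟩
  refine DifferentiableAt.differentiableWithinAt ?_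
  have hs : {w : ℂ | z.im / 2 < w.im} ∈ 𝓝 z :=
    (isOpen_lt continuous_const Complex.continuous_im).mem_nhds (by simpa using hz)
  have hpos : ∀ w ∈ {w : ℂ | z.im / 2 < w.im}, 0 < w.im := fun w hw => by
    have : z.im / 2 < w.im := hw
    linarith
  refine (hasDerivAt_integral_of_dominated_loc_of_deriv_le (μ := volume.restrict A)
    (F := fun w (t : ℝ) => ((t : ℂ) - w)⁻¹) (F' := fun w (t : ℝ) => (((t : ℂ) - w)⁻¹) ^ 2)
    (bound := fun _ => ((z.im / 2)⁻¹) ^ 2) (s := {w : ℂ | z.im / 2 < w.im}) hs ?_ ?_ ?_ ?_ ?_ ?_).2.differentiableAt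
  · filter_upwards [hs] with w hw
    exact (continuous_inv_ofReal_sub (hpos w hw)).aestronglyMeasurable
  · exact integrableOn_inv_ofReal_sub hfin hz
  · exact ((continuous_inv_ofReal_sub hz).pow 2).aestronglyMeasurable
  · refine ae_of_all _ fun t w hw => ?_
    rw [norm_pow]
    refine pow_le_pow_left₀ (norm_nonneg _) ((norm_inv_ofReal_sub_le (hpos w hw) t).trans ?_) 2
    exact inv_anti₀ (by positivity) (le_of_lt hw)
  · exact integrable_const _
  · refine ae_of_all _ fun t w hw => ?_
    have := ((hasDerivAt_id w).const_sub (t : ℂ)).inv (ofReal_sub_ne_zero (hpos w hw) t)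
    refine this.congr_deriv ?_
    simp

lemma continuous_cauchyTransform_line (hfin : volume A < ⊤) {y : ℝ} (hy : 0 < y) :
    Continuous fun x : ℝ => cauchyTransform A (x + y * Complex.I) := by
  refine (differentiableOn_cauchyTransform hfin).continuousOn.comp_continuous (by fun_prop) ?_
  intro x
  simpa using hy

lemma cauchyTransform_line_im (hfin : volume A < ⊤) {y : ℝ} (hy : 0 < y) (x : ℝ) :
    (cauchyTransform A (x + y * Complex.I)).im = ∫ t in A, y / ((t - x) ^ 2 + y ^ 2) := by
  have := cauchyTransform_im (A := A) hfin (z := x + y * Complex.I) (by simpa using hy)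
  simpa using this

lemma integrable_poisson_prod (hfin : volume A < ⊤) {y : ℝ} (hy : 0 < y) :
    Integrable (Function.uncurry fun x t : ℝ => y / ((t - x) ^ 2 + y ^ 2))
      (volume.prod (volume.restrict A)) := by
  have hfm : IsFiniteMeasure (volume.restrict A) := ⟨by simpa using hfin⟩
  have hc : Continuous (Function.uncurry fun x t : ℝ => y / ((t - x) ^ 2 + y ^ 2)) :=
    Continuous.div (by fun_prop) (by fun_prop) fun t => by positivity
  rw [integrable_prod_iff' hc.aestronglyMeasurable]
  have hsymm : ∀ x t : ℝ, y / ((t - x) ^ 2 + y ^ 2) = y / ((x - t) ^ 2 + y ^ 2) :=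
    fun x t => by rw [← neg_sub, neg_sq]
  have hnorm : ∀ x t : ℝ, ‖y / ((t - x) ^ 2 + y ^ 2)‖ = y / ((x - t) ^ 2 + y ^ 2) :=
    fun x t => by rw [Real.norm_of_nonneg (by positivity), hsymm]
  refine ⟨ae_of_all _ fun t => ?_, ?_⟩
  · simp only [Function.uncurry, hsymm _ t]
    exact integrable_poisson hy t
  · simp only [Function.uncurry, hnorm, integral_poisson hy]
    exact integrable_const _

lemma integrable_cauchyTransform_im (hfin : volume A < ⊤) {y : ℝ}
    (hy : 0 < y) : Integrable fun x : ℝ => (cauchyTransform A (x + y * Complex.I)).im := by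
  simp_rw [cauchyTransform_line_im hfin hy]
  exact (integrable_poisson_prod hfin hy).integral_prod_left

lemma integral_cauchyTransform_im (hfin : volume A < ⊤) {y : ℝ}
    (hy : 0 < y) :
    ∫ x : ℝ, (cauchyTransform A (x + y * Complex.I)).im = Real.pi * volume.real A := by
  simp_rw [cauchyTransform_line_im hfin hy]
  rw [integral_integral_swap (integrable_poisson_prod hfin hy)]
  have hsymm : ∀ x t : ℝ, y / ((t - x) ^ 2 + y ^ 2) = y / ((x - t) ^ 2 + y ^ 2) :=
    fun x t => by rw [← neg_sub, neg_sq]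
  have : ∀ t : ℝ, ∫ x : ℝ, y / ((t - x) ^ 2 + y ^ 2) = Real.pi := fun t => by
    rw [← integral_poisson hy t]
    exact integral_congr_ae (ae_of_all _ fun x => hsymm x t)
  simp [this, mul_comm]

lemma integrable_cauchyTransform_sq (hfin : volume A < ⊤) {y : ℝ}
    (hy : 0 < y) : Integrable fun x : ℝ => ‖cauchyTransform A (x + y * Complex.I)‖ ^ 2 := by
  refine ((integrable_cauchyTransform_im hfin hy).const_mul (volume.real A / y)).mono'
    ((continuous_cauchyTransform_line hfin hy).norm.pow 2).aestronglyMeasurable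
    (ae_of_all _ fun x => ?_)
  rw [Real.norm_of_nonneg (by positivity)]
  simpa using norm_sq_cauchyTransform_le hfin (z := x + y * Complex.I) (by simpa using hy)

lemma integral_cauchyTransform_sq_le (hfin : volume A < ⊤) {y : ℝ}
    (hy : 0 < y) : ∫ x : ℝ, ‖cauchyTransform A (x + y * Complex.I)‖ ^ 2 ≤
      volume.real A / y * (Real.pi * volume.real A) := by
  rw [← integral_cauchyTransform_im hfin hy, ← integral_const_mul]
  refine integral_mono (integrable_cauchyTransform_sq hfin hy)
    ((integrable_cauchyTransform_im hfin hy).const_mul _) fun x => ?_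
  simpa using norm_sq_cauchyTransform_le hfin (z := x + y * Complex.I) (by simpa using hy)

/-- The Cauchy transform tends to zero at horizontal infinity, uniformly in `Im z ≥ y₀`. -/
lemma exists_cauchyTransform_tail (hfin : volume A < ⊤) {y₀ : ℝ} (hy₀ : 0 < y₀) :
    ∃ b : ℝ → ℝ, Tendsto b (cocompact ℝ) (𝓝 0) ∧
      ∀ x y : ℝ, y₀ ≤ y → ‖cauchyTransform A (x + y * Complex.I)‖ ≤ b x := by
  have hfm : IsFiniteMeasure (volume.restrict A) := ⟨by simpa using hfin⟩
  have hcg : (cocompact ℝ).IsCountablyGenerated := by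
    rw [cocompact_eq_atBot_atTop]; infer_instance
  have him : ∀ x : ℝ, 0 < ((x : ℂ) + y₀ * Complex.I).im := fun x => by simpa using hy₀
  refine ⟨fun x => ∫ t in A, ‖((t : ℂ) - (x + y₀ * Complex.I))⁻¹‖, ?_, fun x y hy => ?_⟩
  · have := tendsto_integral_filter_of_dominated_convergence (μ := volume.restrict A)
      (l := cocompact ℝ) (F := fun (x : ℝ) (t : ℝ) => ‖((t : ℂ) - (x + y₀ * Complex.I))⁻¹‖)
      (f := fun _ => 0) (fun _ => y₀⁻¹)
      (Eventually.of_forall fun x => (continuous_inv_ofReal_sub (him x)).norm.aestronglyMeasurable)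
      (Eventually.of_forall fun x => ae_of_all _ fun t => by
        rw [norm_norm]; simpa using norm_inv_ofReal_sub_le (him x) t)
      (integrable_const _) (ae_of_all _ fun t => ?_)
    · simpa using this
    · simp_rw [norm_inv]
      refine tendsto_inv_atTop_zero.comp ?_
      refine tendsto_atTop_mono (f := fun x : ℝ => ‖x‖ - ‖t‖) (fun x => ?_)
        (tendsto_atTop_add_const_right _ _ (tendsto_norm_cocompact_atTop))
      have := Complex.abs_re_le_norm ((t : ℂ) - (x + y₀ * Complex.I))
      simp only [Complex.sub_re, Complex.add_re, Complex.ofReal_re, Complex.mul_re, Complex.I_re,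
        mul_zero, Complex.ofReal_im, Complex.I_im, zero_mul, sub_self, add_zero] at this
      refine le_trans ?_ this
      rw [abs_sub_comm]
      exact abs_sub_abs_le_abs_sub x t
  · have hy' : 0 < ((x : ℂ) + y * Complex.I).im := by simpa using hy₀.trans_le hy
    refine (norm_integral_le_integral_norm _).trans ?_
    refine integral_mono (integrableOn_inv_ofReal_sub hfin hy').norm
      (integrableOn_inv_ofReal_sub hfin (him x)).norm fun t => ?_
    simp only [norm_inv]
    refine inv_anti₀ (norm_pos_iff.2 (ofReal_sub_ne_zero (him x) t)) ?_
    rw [← sq_le_sq₀ (norm_nonneg _) (norm_nonneg _), ← Complex.normSq_eq_norm_sq,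
      ← Complex.normSq_eq_norm_sq, normSq_ofReal_sub, normSq_ofReal_sub]
    simp
    exact pow_le_pow_left₀ hy₀.le hy 2
end

/-- A holomorphic function on a half-plane which decays at infinity has zero integral over
its boundary line. -/
lemma integral_line_eq_zero {K : ℂ → ℂ} {y₀ : ℝ} (hK : DifferentiableOn ℂ K {z | y₀ ≤ z.im})
    {b : ℝ → ℝ} (hb : Tendsto b (cocompact ℝ) (𝓝 0))
    (hKb : ∀ᶠ x : ℝ in cocompact ℝ, ∀ y : ℝ, y₀ ≤ y → ‖K (x + y * Complex.I)‖ ≤ b x)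
    (hInt : Integrable fun x : ℝ => K (x + y₀ * Complex.I))
    {c : ℝ → ℝ} (hc : Tendsto c atTop (𝓝 0))
    (hKc : ∀ᶠ Y : ℝ in atTop, Integrable (fun x : ℝ => K (x + Y * Complex.I)) ∧
      ‖∫ x : ℝ, K (x + Y * Complex.I)‖ ≤ c Y) :
    ∫ x : ℝ, K (x + y₀ * Complex.I) = 0 := by
  have heq : ∀ Y : ℝ, y₀ ≤ Y → Integrable (fun x : ℝ => K (x + Y * Complex.I)) →
      ∫ x : ℝ, K (x + y₀ * Complex.I) = ∫ x : ℝ, K (x + Y * Complex.I) := by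
    intro Y hY hYint
    have hside : ∀ l : Filter ℝ, l ≤ cocompact ℝ → Tendsto
        (fun R : ℝ => ∫ y in y₀..Y, K ((R : ℂ) + y * Complex.I)) l (𝓝 0) := by
      intro l hl
      refine squeeze_zero_norm' (a := fun R => b R * |Y - y₀|) ?_
        (by simpa using (hb.mono_left hl).mul_const |Y - y₀|)
      filter_upwards [hl hKb] with R hR
      refine intervalIntegral.norm_integral_le_of_norm_le_const fun y hy => hR y ?_
      rw [uIoc_of_le hY] at hy
      exact hy.1.le
    have h1 := intervalIntegral_tendsto_integral hInt tendsto_neg_atTop_atBot tendsto_id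
    have h2 := intervalIntegral_tendsto_integral hYint tendsto_neg_atTop_atBot tendsto_id
    have h3 := hside atTop atTop_le_cocompact
    have h4 := (hside atBot atBot_le_cocompact).comp tendsto_neg_atTop_atBot
    have h5 := ((h1.sub h2).add (h3.const_smul Complex.I)).sub (h4.const_smul Complex.I)
    have h6 : ∀ R : ℝ, ((∫ x : ℝ in -R..R, K (x + y₀ * Complex.I)) -
        (∫ x : ℝ in -R..R, K (x + Y * Complex.I)) +
        Complex.I • (∫ y : ℝ in y₀..Y, K ((R : ℂ) + y * Complex.I)) -
        Complex.I • (∫ y : ℝ in y₀..Y, K (((-R : ℝ) : ℂ) + y * Complex.I))) = 0 := by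
      intro R
      have := Complex.integral_boundary_rect_eq_zero_of_differentiableOn K
        (⟨-R, y₀⟩ : ℂ) (⟨R, Y⟩ : ℂ) (hK.mono fun z hz => ?_)
      · exact this
      · have := hz.2
        simp only [mem_preimage, uIcc_of_le hY] at this
        exact this.1
    have h7 := tendsto_nhds_unique (h5.congr fun R => h6 R) tendsto_const_nhds
    simpa [sub_eq_zero] using h7
  have hle : ∀ᶠ Y in atTop, ‖∫ x : ℝ, K (x + y₀ * Complex.I)‖ ≤ c Y := by
    filter_upwards [hKc, eventually_ge_atTop y₀] with Y hY hYy
    rw [heq Y hYy hY.1]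
    exact hY.2
  have := ge_of_tendsto hc hle
  exact norm_le_zero_iff.1 this

section
variable {A : Set ℝ}

/-- Vanishing of `∫ F² R(θF)` over horizontal lines, for `F` the Cauchy transform and `R`
holomorphic on the strip `|Im w| < π`. -/
lemma integral_cauchyTransform_sq_mul (hfin : volume A < ⊤)
    {R : ℂ → ℂ} (hR : DifferentiableOn ℂ R {w | |w.im| < Real.pi}) {θ : ℝ} (hθ0 : 0 ≤ θ)
    (hθ1 : θ < 1) {y₀ : ℝ} (hy₀ : 0 < y₀) :
    Integrable (fun x : ℝ => cauchyTransform A (x + y₀ * Complex.I) ^ 2 *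
      R (θ * cauchyTransform A (x + y₀ * Complex.I))) ∧
    ∫ x : ℝ, cauchyTransform A (x + y₀ * Complex.I) ^ 2 *
      R (θ * cauchyTransform A (x + y₀ * Complex.I)) = 0 := by
  set S : Set ℂ := Metric.closedBall 0 (volume.real A / y₀) ∩ {w | |w.im| ≤ θ * Real.pi} with hS
  have hSc : IsCompact S := (isCompact_closedBall _ _).inter_right
    (isClosed_le (Complex.continuous_im.abs) continuous_const)
  have hθπ : θ * Real.pi < Real.pi := by nlinarith [Real.pi_pos]
  obtain ⟨C, hC⟩ := hSc.exists_bound_of_continuousOn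
    (hR.continuousOn.mono fun w hw => lt_of_le_of_lt hw.2 hθπ)
  have habs : ∀ z : ℂ, 0 < z.im → |((θ : ℂ) * cauchyTransform A z).im| ≤ θ * Real.pi := by
    intro z hz
    rw [Complex.im_ofReal_mul, abs_mul, abs_of_nonneg hθ0,
      abs_of_nonneg (cauchyTransform_im_nonneg hfin hz)]
    exact mul_le_mul_of_nonneg_left (cauchyTransform_im_le_pi hfin hz) hθ0
  have hbound : ∀ x y : ℝ, y₀ ≤ y → ‖R (θ * cauchyTransform A (x + y * Complex.I))‖ ≤ C := by
    intro x y hy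
    have hpos : 0 < ((x : ℂ) + y * Complex.I).im := by simpa using hy₀.trans_le hy
    refine hC _ ⟨?_, habs _ hpos⟩
    rw [mem_closedBall_zero_iff, norm_mul, Complex.norm_real, Real.norm_of_nonneg hθ0]
    have h1 := norm_cauchyTransform_le (A := A) hfin hpos
    have h2 : volume.real A / ((x : ℂ) + y * Complex.I).im ≤ volume.real A / y₀ := by
      simp only [Complex.add_im, Complex.ofReal_im, Complex.mul_im, Complex.ofReal_re,
        Complex.I_im, mul_one, Complex.I_re, mul_zero, add_zero, zero_add]
      exact div_le_div_of_nonneg_left measureReal_nonneg hy₀ hy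
    have := norm_nonneg (cauchyTransform A (x + y * Complex.I))
    nlinarith
  have hC0 : 0 ≤ C := (norm_nonneg _).trans (hbound 0 y₀ le_rfl)
  set K : ℂ → ℂ := fun z => cauchyTransform A z ^ 2 * R (θ * cauchyTransform A z) with hKdef
  have hF := differentiableOn_cauchyTransform (A := A) hfin
  have hK : DifferentiableOn ℂ K {z | 0 < z.im} := by
    refine (hF.pow 2).mul (hR.comp (hF.const_mul _) fun z hz => ?_)
    exact (habs z hz).trans_lt hθπ
  have hKle : ∀ x y : ℝ, y₀ ≤ y → ‖K (x + y * Complex.I)‖ ≤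
      C * ‖cauchyTransform A (x + y * Complex.I)‖ ^ 2 := by
    intro x y hy
    rw [hKdef]
    simp only [norm_mul, norm_pow]
    rw [mul_comm]
    exact mul_le_mul_of_nonneg_right (hbound x y hy) (by positivity)
  have hKint : ∀ y : ℝ, y₀ ≤ y → Integrable fun x : ℝ => K (x + y * Complex.I) := by
    intro y hy
    have hy' := hy₀.trans_le hy
    refine ((integrable_cauchyTransform_sq hfin hy').const_mul C).mono' ?_
      (ae_of_all _ fun x => hKle x y hy)
    refine Continuous.aestronglyMeasurable ?_
    refine hK.continuousOn.comp_continuous (by fun_prop) fun x => ?_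
    simpa using hy'
  refine ⟨hKint y₀ le_rfl, ?_⟩
  obtain ⟨b, hb, hFb⟩ := exists_cauchyTransform_tail (A := A) hfin hy₀
  refine integral_line_eq_zero (hK.mono fun z hz => hy₀.trans_le hz) (b := fun x => C * b x ^ 2)
    (by simpa using (hb.pow 2).const_mul C) (Eventually.of_forall fun x y hy => ?_)
    (hKint y₀ le_rfl) (c := fun y => C * (volume.real A / y * (Real.pi * volume.real A))) ?_ ?_
  · refine (hKle x y hy).trans (mul_le_mul_of_nonneg_left ?_ hC0)
    exact pow_le_pow_left₀ (norm_nonneg _) (hFb x y hy) 2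
  · have : Tendsto (fun y : ℝ => volume.real A / y) atTop (𝓝 0) :=
      tendsto_const_nhds.div_atTop tendsto_id
    simpa using (this.mul_const (Real.pi * volume.real A)).const_mul C
  · filter_upwards [eventually_ge_atTop y₀] with y hy
    refine ⟨hKint y hy, (norm_integral_le_of_norm_le
      ((integrable_cauchyTransform_sq hfin (hy₀.trans_le hy)).const_mul C)
      (ae_of_all _ fun x => hKle x y hy)).trans ?_⟩
    rw [integral_const_mul]
    exact mul_le_mul_of_nonneg_left (integral_cauchyTransform_sq_le hfin (hy₀.trans_le hy)) hC0

/-- Uniform `L²` bound for the Cauchy transform on horizontal lines. -/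
lemma integral_norm_cauchyTransform_sq_le (hfin : volume A < ⊤) {y : ℝ} (hy : 0 < y) :
    ∫ x : ℝ, ‖cauchyTransform A (x + y * Complex.I)‖ ^ 2 ≤
      2 * Real.pi * (Real.pi * volume.real A) := by
  obtain ⟨h1, h2⟩ := integral_cauchyTransform_sq_mul (A := A) hfin (R := fun _ => 1)
    (differentiableOn_const _) le_rfl zero_lt_one hy
  simp only [mul_one] at h1 h2
  have h3 : ∫ x : ℝ, (cauchyTransform A (x + y * Complex.I) ^ 2).re = 0 := by
    have := integral_re h1
    simp only [RCLike.re_to_complex] at this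
    rw [this, h2, Complex.zero_re]
  have h4 : Integrable fun x : ℝ => (cauchyTransform A (x + y * Complex.I) ^ 2).re := h1.re
  have h5 := integral_sub (integrable_cauchyTransform_sq hfin hy) h4
  rw [h3, sub_zero] at h5
  rw [← h5, ← integral_cauchyTransform_im hfin hy, ← integral_const_mul]
  refine integral_mono ((integrable_cauchyTransform_sq hfin hy).sub h4)
    ((integrable_cauchyTransform_im hfin hy).const_mul _) fun x => ?_
  have hpos : 0 < ((x : ℂ) + y * Complex.I).im := by simpa using hy
  have hn := cauchyTransform_im_nonneg (A := A) hfin hpos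
  have hp := cauchyTransform_im_le_pi (A := A) hfin hpos
  set w := cauchyTransform A (x + y * Complex.I)
  have e1 : ‖w‖ ^ 2 = w.re ^ 2 + w.im ^ 2 := by
    rw [← Complex.normSq_eq_norm_sq, Complex.normSq_apply]; ring
  have e2 : (w ^ 2).re = w.re ^ 2 - w.im ^ 2 := by simp [sq]
  simp only [e1, e2]
  nlinarith
end

section
variable {A : Set ℝ}

/-- Poisson representation of the Cauchy transform by its values on a horizontal line. -/
lemma integral_poisson_mul_cauchyTransform (hfin : volume A < ⊤) {η y : ℝ} (hη : 0 < η)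
    (hy : 0 < y) (x₀ : ℝ) :
    ∫ t : ℝ, ((y / ((t - x₀) ^ 2 + y ^ 2) : ℝ) : ℂ) * cauchyTransform A (t + η * Complex.I) =
      Real.pi * cauchyTransform A (x₀ + (y + η : ℝ) * Complex.I) := by
  set F := cauchyTransform A with hFdef
  set z₀ : ℂ := x₀ + (y + η : ℝ) * Complex.I with hz₀
  set z₁ : ℂ := x₀ + (η - y : ℝ) * Complex.I with hz₁
  have hz₀im : z₀.im = y + η := by simp [hz₀]
  have hz₁im : z₁.im = η - y := by simp [hz₁]
  have hz₀re : z₀.re = x₀ := by simp [hz₀]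
  have hz₁re : z₁.re = x₀ := by simp [hz₁]
  set M := volume.real A / η + volume.real A / η with hM
  have hFle : ∀ z : ℂ, η ≤ z.im → ‖F z‖ ≤ volume.real A / η := fun z hz =>
    (norm_cauchyTransform_le hfin (hη.trans_le hz)).trans
      (div_le_div_of_nonneg_left measureReal_nonneg hη hz)
  have hM0 : 0 ≤ M := by
    have : 0 ≤ volume.real A / η := div_nonneg measureReal_nonneg hη.le
    positivity
  have hFM : ∀ z : ℂ, η ≤ z.im → ‖F z - F z₀‖ ≤ M := fun z hz =>
    (norm_sub_le _ _).trans (add_le_add (hFle z hz) (hFle z₀ (by rw [hz₀im]; linarith)))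
  set K : ℂ → ℂ := fun z => dslope F z₀ z / (z - z₁) with hKdef
  have hne : ∀ z : ℂ, η ≤ z.im → z - z₁ ≠ 0 := by
    intro z hz h
    have := congrArg Complex.im h
    rw [Complex.sub_im, hz₁im, Complex.zero_im] at this
    linarith
  have hds : DifferentiableOn ℂ (dslope F z₀) {z | 0 < z.im} := by
    rw [Complex.differentiableOn_dslope]
    · exact differentiableOn_cauchyTransform hfin
    · refine (isOpen_lt continuous_const Complex.continuous_im).mem_nhds ?_
      simp only [mem_ofPred_eq, hz₀im]
      positivity
  have hK : DifferentiableOn ℂ K {z | η ≤ z.im} :=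
    (hds.mono fun z hz => hη.trans_le hz).div (by fun_prop) hne
  have hKeq : ∀ z, z ≠ z₀ → K z = (F z - F z₀) / ((z - z₀) * (z - z₁)) := by
    intro z hz
    simp only [hKdef, dslope_of_ne _ hz, slope_def_field]
    rw [div_div]
  have hnsq : ∀ x Y : ℝ, ‖(x : ℂ) + Y * Complex.I - z₀‖ ^ 2 = (x - x₀) ^ 2 + (Y - η - y) ^ 2 := by
    intro x Y
    rw [← Complex.normSq_eq_norm_sq, Complex.normSq_apply]
    simp [hz₀im, hz₀re]
    ring
  have hnle : ∀ x Y : ℝ, η ≤ Y →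
      ‖(x : ℂ) + Y * Complex.I - z₀‖ ≤ ‖(x : ℂ) + Y * Complex.I - z₁‖ := by
    intro x Y hY
    rw [← sq_le_sq₀ (norm_nonneg _) (norm_nonneg _), hnsq, ← Complex.normSq_eq_norm_sq,
      Complex.normSq_apply]
    simp [hz₁im, hz₁re]
    nlinarith [mul_nonneg (sub_nonneg.2 hY) hy.le]
  have hKle : ∀ x Y : ℝ, η ≤ Y → 0 < (x - x₀) ^ 2 + (Y - η - y) ^ 2 →
      ‖K (x + Y * Complex.I)‖ ≤ M / ((x - x₀) ^ 2 + (Y - η - y) ^ 2) := by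
    intro x Y hY hpos
    have hneq : (x : ℂ) + Y * Complex.I ≠ z₀ := by
      intro h
      have := hnsq x Y
      rw [h, sub_self, norm_zero] at this
      linarith
    rw [hKeq _ hneq, norm_div, norm_mul]
    refine div_le_div₀ hM0 (hFM _ (by simpa using hY)) hpos ?_
    rw [← hnsq, sq]
    exact mul_le_mul_of_nonneg_left (hnle x Y hY) (norm_nonneg _)
  have hKint : ∀ Y : ℝ, η ≤ Y → Y - η - y ≠ 0 → Integrable (fun x : ℝ => K (x + Y * Complex.I)) ∧
      ‖∫ x : ℝ, K (x + Y * Complex.I)‖ ≤ M / |Y - η - y| * Real.pi := by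
    intro Y hY hd
    have hd' : 0 < |Y - η - y| := abs_pos.2 hd
    have hle : ∀ x : ℝ, ‖K (x + Y * Complex.I)‖ ≤
        M / |Y - η - y| * (|Y - η - y| / ((x - x₀) ^ 2 + |Y - η - y| ^ 2)) := by
      intro x
      refine (hKle x Y hY (by positivity)).trans (le_of_eq ?_)
      rw [sq_abs]
      field_simp
    have hi := (integrable_poisson hd' x₀).const_mul (M / |Y - η - y|)
    refine ⟨hi.mono' ?_ (ae_of_all _ hle), ?_⟩
    · refine Continuous.aestronglyMeasurable ?_
      refine hK.continuousOn.comp_continuous (by fun_prop) fun x => ?_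
      simpa using hY
    · refine (norm_integral_le_of_norm_le hi (ae_of_all _ hle)).trans (le_of_eq ?_)
      rw [integral_const_mul, integral_poisson hd']
  have hzero : ∫ x : ℝ, K (x + η * Complex.I) = 0 := by
    refine integral_line_eq_zero hK (b := fun x => M / (x - x₀) ^ 2) ?_ ?_
      (hKint η le_rfl (by simpa using hy.ne')).1
      (c := fun Y => M / |Y - η - y| * Real.pi) ?_ ?_
    · refine tendsto_const_nhds.div_atTop ?_
      have h1 : Tendsto (fun x : ℝ => ‖x - x₀‖) (cocompact ℝ) atTop := by
        refine tendsto_atTop_mono (f := fun x : ℝ => ‖x‖ - ‖x₀‖)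
          (fun x => norm_sub_norm_le x x₀)
          (tendsto_atTop_add_const_right _ _ tendsto_norm_cocompact_atTop)
      refine ((tendsto_pow_atTop two_ne_zero).comp h1).congr fun x => ?_
      simp
    · have : {x₀}ᶜ ∈ cocompact ℝ := isCompact_singleton.compl_mem_cocompact
      filter_upwards [this] with x hx y' hy'
      have hx' : 0 < (x - x₀) ^ 2 := by
        have : x - x₀ ≠ 0 := sub_ne_zero.2 hx
        positivity
      refine (hKle x y' hy' (by positivity)).trans ?_
      refine div_le_div_of_nonneg_left hM0 hx' ?_
      nlinarith [sq_nonneg (y' - η - y)]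
    · have h1 : Tendsto (fun Y : ℝ => |Y - η - y|) atTop atTop := by
        refine tendsto_abs_atTop_atTop.comp ?_
        simp_rw [sub_eq_add_neg]
        exact tendsto_atTop_add_const_right _ _ (tendsto_atTop_add_const_right _ _ tendsto_id)
      simpa using (tendsto_const_nhds.div_atTop h1).mul_const Real.pi
    · filter_upwards [eventually_gt_atTop (η + y)] with Y hY
      exact hKint Y (by linarith) (by linarith)
  have hP := integrable_poisson hy x₀
  have hPc : Integrable fun t : ℝ => ((y / ((t - x₀) ^ 2 + y ^ 2) : ℝ) : ℂ) := hP.ofReal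
  have hPi : ∫ t : ℝ, ((y / ((t - x₀) ^ 2 + y ^ 2) : ℝ) : ℂ) = Real.pi := by
    rw [integral_complex_ofReal, integral_poisson hy]
  have hPF : Integrable fun t : ℝ => ((y / ((t - x₀) ^ 2 + y ^ 2) : ℝ) : ℂ) *
      F (t + η * Complex.I) := by
    refine hPc.mul_bdd (c := volume.real A / η)
      (continuous_cauchyTransform_line hfin hη).aestronglyMeasurable (ae_of_all _ fun t => ?_)
    exact hFle _ (by simp)
  have hsplit : ∀ t : ℝ, (y : ℂ) * K (t + η * Complex.I) =
      ((y / ((t - x₀) ^ 2 + y ^ 2) : ℝ) : ℂ) * F (t + η * Complex.I) -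
        ((y / ((t - x₀) ^ 2 + y ^ 2) : ℝ) : ℂ) * F z₀ := by
    intro t
    have hneq : (t : ℂ) + η * Complex.I ≠ z₀ := by
      intro h
      have := congrArg Complex.im h
      rw [hz₀im] at this
      simp at this
      linarith
    rw [hKeq _ hneq]
    have : ((t : ℂ) + η * Complex.I - z₀) * ((t : ℂ) + η * Complex.I - z₁) =
        (((t - x₀) ^ 2 + y ^ 2 : ℝ) : ℂ) := by
      rw [hz₀, hz₁]
      push_cast
      linear_combination (-(y : ℂ) ^ 2) * Complex.I_sq
    rw [this, Complex.ofReal_div]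
    ring
  have hfinal : ∫ t : ℝ, (y : ℂ) * K (t + η * Complex.I) = 0 := by
    rw [integral_const_mul, hzero, mul_zero]
  simp_rw [hsplit] at hfinal
  rw [integral_sub hPF (hPc.mul_const _), integral_mul_const, hPi, sub_eq_zero] at hfinal
  exact hfinal

lemma memLp_cauchyTransform (hfin : volume A < ⊤) {y : ℝ} (hy : 0 < y) :
    MemLp (fun x : ℝ => cauchyTransform A (x + y * Complex.I)) 2 :=
  (memLp_two_iff_integrable_sq_norm
    (continuous_cauchyTransform_line hfin hy).aestronglyMeasurable).2
    (integrable_cauchyTransform_sq hfin hy)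

/-- The Cauchy transform is the Poisson integral of an `L²` function. -/
lemma exists_boundary_value (hfin : volume A < ⊤) :
    ∃ f : ℝ → ℂ, Measurable f ∧ MemLp f 2 ∧ ∀ x y : ℝ, 0 < y →
      ∫ t : ℝ, ((y / ((t - x) ^ 2 + y ^ 2) : ℝ) : ℂ) * f t =
        Real.pi * cauchyTransform A (x + y * Complex.I) := by
  let E := Lp ℂ 2 (volume : Measure ℝ)
  let f : ℝ → E := fun η => if h : 0 < η then (memLp_cauchyTransform (A := A) hfin h).toLp else 0
  set C := Real.sqrt (2 * Real.pi * (Real.pi * volume.real A))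
  have hfC : ∀ η, ‖f η‖ ≤ C := by
    intro η
    by_cases h : 0 < η
    · simp only [f, h, dif_pos]
      refine Real.le_sqrt_of_sq_le ?_
      have := integral_norm_cauchyTransform_sq_le (A := A) hfin h
      refine le_trans (le_of_eq ?_) this
      rw [norm_sq_eq_re_inner (𝕜 := ℂ), L2.inner_def, ← integral_re (L2.integrable_inner _ _)]
      refine integral_congr_ae ?_
      filter_upwards [(memLp_cauchyTransform (A := A) hfin h).coeFn_toLp] with t ht
      rw [ht, ← norm_sq_eq_re_inner]
    · simp only [f, h, dif_neg, not_false_eq_true, norm_zero]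
      exact Real.sqrt_nonneg _
  let Φ : ℝ → WeakDual ℂ E := fun η => StrongDual.toWeakDual (InnerProductSpace.toDual ℂ E (f η))
  let U : Ultrafilter ℝ := Ultrafilter.of (𝓝[>] (0 : ℝ))
  have hU : (U : Filter ℝ) ≤ 𝓝[>] 0 := Ultrafilter.of_le _
  obtain ⟨ℓ, -, hℓ⟩ := (WeakDual.isCompact_closedBall (0 : StrongDual ℂ E) C).ultrafilter_le_nhds
    (U.map Φ) (by
      simp only [le_principal_iff]
      refine Filter.Eventually.of_forall (p := fun η => Φ η ∈ _) fun η => ?_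
      simpa [Φ] using hfC η)
  have hlim : ∀ g : E, Tendsto (fun η => inner ℂ (f η) g) U (𝓝 (ℓ g)) := fun g =>
    ((WeakDual.eval_continuous g).tendsto ℓ).comp hℓ
  set f₀ : E := (InnerProductSpace.toDual ℂ E).symm (WeakDual.toStrongDual ℓ) with hf₀
  have hℓ₀ : ∀ g : E, ℓ g = inner ℂ f₀ g := by
    intro g
    rw [← InnerProductSpace.toDual_apply_apply, hf₀, LinearIsometryEquiv.apply_symm_apply]
    rfl
  refine ⟨f₀, (Lp.stronglyMeasurable f₀).measurable, Lp.memLp f₀, fun x y hy => ?_⟩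
  have hPm : MemLp (fun t : ℝ => ((y / ((t - x) ^ 2 + y ^ 2) : ℝ) : ℂ)) 2 :=
    (memLp_poisson hy x).ofReal
  have hinner : ∀ h : E, inner ℂ hPm.toLp h =
      ∫ t : ℝ, ((y / ((t - x) ^ 2 + y ^ 2) : ℝ) : ℂ) * h t := by
    intro h
    rw [L2.inner_def]
    refine integral_congr_ae ?_
    filter_upwards [hPm.coeFn_toLp] with t ht
    rw [ht, RCLike.inner_apply, Complex.conj_ofReal, mul_comm]
  have h1 : Tendsto (fun η => inner ℂ hPm.toLp (f η)) U (𝓝 (inner ℂ hPm.toLp f₀)) := by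
    have := (Complex.continuous_conj.tendsto _).comp (hlim hPm.toLp)
    rw [hℓ₀, inner_conj_symm] at this
    exact this.congr fun η => inner_conj_symm _ _
  have h2 : Tendsto (fun η => inner ℂ hPm.toLp (f η)) U
      (𝓝 (Real.pi * cauchyTransform A (x + y * Complex.I))) := by
    have hc : Tendsto (fun η : ℝ => cauchyTransform A (x + (y + η : ℝ) * Complex.I)) (𝓝 0)
        (𝓝 (cauchyTransform A (x + y * Complex.I))) := by
      have h3 : ContinuousAt (cauchyTransform A) (x + (y + 0 : ℝ) * Complex.I) := by
        refine (differentiableOn_cauchyTransform hfin).continuousOn.continuousAt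
          ((isOpen_lt continuous_const Complex.continuous_im).mem_nhds ?_)
        simpa using hy
      have h4 : ContinuousAt (fun η : ℝ => (x : ℂ) + (y + η : ℝ) * Complex.I) 0 := by fun_prop
      have := ContinuousAt.comp (f := fun η : ℝ => (x : ℂ) + (y + η : ℝ) * Complex.I) h3 h4
      simpa [ContinuousAt, Function.comp_def] using this
    refine ((hc.mono_left (hU.trans nhdsWithin_le_nhds)).const_mul (Real.pi : ℂ)).congr' ?_
    filter_upwards [hU self_mem_nhdsWithin] with η hη
    have hη : 0 < η := hη
    rw [← integral_poisson_mul_cauchyTransform hfin hη hy, hinner]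
    refine integral_congr_ae ?_
    simp only [f, hη, dif_pos]
    filter_upwards [(memLp_cauchyTransform (A := A) hfin hη).coeFn_toLp] with t ht
    rw [ht]
  rw [← hinner]
  exact tendsto_nhds_unique h1 h2
end

lemma enorm_poisson_mul {y : ℝ} (hy : 0 < y) (x t : ℝ) (w : ℂ) :
    ‖((y / ((t - x) ^ 2 + y ^ 2) : ℝ) : ℂ) * w‖ₑ =
      ENNReal.ofReal (y / ((t - x) ^ 2 + y ^ 2)) * ‖w‖ₑ := by
  rw [enorm_mul]
  congr 1
  rw [← ofReal_norm, Complex.norm_real, Real.norm_of_nonneg (by positivity)]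

lemma tendsto_of_enorm_sub_le {g : ℝ → ℂ} {a : ℂ} {J : ℝ → ℝ≥0∞}
    (hJ : Tendsto J (𝓝[>] 0) (𝓝 0)) (hle : ∀ y : ℝ, 0 < y → ‖g y - a‖ₑ ≤ J y) :
    Tendsto g (𝓝[>] 0) (𝓝 a) := by
  rw [tendsto_iff_edist_tendsto_0]
  refine tendsto_of_tendsto_of_tendsto_of_le_of_le' tendsto_const_nhds hJ
    (Eventually.of_forall fun _ => zero_le) ?_
  filter_upwards [self_mem_nhdsWithin] with y hy
  rw [edist_eq_enorm_sub]
  exact hle y hy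

/-- Poisson integrals converge at Lebesgue points. -/
lemma tendsto_poisson_integral {f : ℝ → ℂ} (hf : MemLp f 2) {x : ℝ}
    (hx : Tendsto (fun y : ℝ => ∫⁻ t, ENNReal.ofReal (y / ((t - x) ^ 2 + y ^ 2)) *
      ‖f t - f x‖ₑ) (𝓝[>] 0) (𝓝 0)) :
    Tendsto (fun y : ℝ => ∫ t : ℝ, ((y / ((t - x) ^ 2 + y ^ 2) : ℝ) : ℂ) * f t)
      (𝓝[>] 0) (𝓝 (Real.pi * f x)) := by
  refine tendsto_of_enorm_sub_le hx fun y hy => ?_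
  have hPm : MemLp (fun t : ℝ => ((y / ((t - x) ^ 2 + y ^ 2) : ℝ) : ℂ)) 2 :=
    (memLp_poisson hy x).ofReal
  have hPc : Integrable fun t : ℝ => ((y / ((t - x) ^ 2 + y ^ 2) : ℝ) : ℂ) :=
    (integrable_poisson hy x).ofReal
  have hPi : ∫ t : ℝ, ((y / ((t - x) ^ 2 + y ^ 2) : ℝ) : ℂ) = Real.pi := by
    rw [integral_complex_ofReal, integral_poisson hy]
  have hi : Integrable fun t : ℝ => ((y / ((t - x) ^ 2 + y ^ 2) : ℝ) : ℂ) * f t :=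
    hPm.integrable_mul hf
  rw [← hPi, ← integral_mul_const, ← integral_sub hi (hPc.mul_const _)]
  refine (enorm_integral_le_lintegral_enorm _).trans (le_of_eq ?_)
  refine lintegral_congr fun t => ?_
  rw [← mul_sub, enorm_poisson_mul hy]

section
variable {A : Set ℝ}

/-- The difference between the truncated kernel `1_{|u| > ε} / u` and the conjugate Poisson
kernel `u / (u² + ε²)`. -/
noncomputable def truncDiff (ε u : ℝ) : ℝ :=
  (if ε < |u| then u⁻¹ else 0) - u / (u ^ 2 + ε ^ 2)

lemma measurable_truncDiff (ε : ℝ) : Measurable (truncDiff ε) := by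
  refine Measurable.sub (Measurable.ite ?_ measurable_inv measurable_const) (by fun_prop)
  exact measurableSet_lt measurable_const measurable_id.abs

lemma abs_truncDiff_le {ε : ℝ} (hε : 0 < ε) (u : ℝ) :
    |truncDiff ε u| ≤ ε / (u ^ 2 + ε ^ 2) := by
  rw [truncDiff]
  split_ifs with h
  · have hu : 0 < |u| := hε.trans h
    have hu0 : u ≠ 0 := abs_pos.1 hu
    have : u⁻¹ - u / (u ^ 2 + ε ^ 2) = ε ^ 2 / (u * (u ^ 2 + ε ^ 2)) := by
      field_simp
      ring
    rw [this, abs_div, abs_mul, abs_of_pos (show 0 < u ^ 2 + ε ^ 2 by positivity),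
      abs_of_pos (show 0 < ε ^ 2 by positivity), div_le_div_iff₀ (by positivity) (by positivity)]
    have := mul_pos hε (sub_pos.2 h)
    have h2 : 0 < u ^ 2 + ε ^ 2 := by positivity
    nlinarith [mul_pos this h2]
  · rw [zero_sub, abs_neg, abs_div, abs_of_pos (show 0 < u ^ 2 + ε ^ 2 by positivity)]
    exact div_le_div_of_nonneg_right (not_lt.1 h) (by positivity)

lemma truncDiff_neg (ε u : ℝ) : truncDiff ε (-u) = -truncDiff ε u := by
  simp only [truncDiff, abs_neg, neg_sq, inv_neg]
  split_ifs <;> ring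

lemma integral_truncDiff (ε x : ℝ) : ∫ t : ℝ, truncDiff ε (t - x) = 0 := by
  rw [integral_sub_right_eq_self (truncDiff ε)]
  have h := integral_neg_eq_self (truncDiff ε) volume
  simp_rw [truncDiff_neg, integral_neg] at h
  linarith

lemma integrable_truncDiff {ε : ℝ} (hε : 0 < ε) (x : ℝ) :
    Integrable fun t : ℝ => truncDiff ε (t - x) :=
  (integrable_poisson hε x).mono'
    ((measurable_truncDiff ε).comp (measurable_id.sub_const x)).aestronglyMeasurable
    (ae_of_all _ fun t => abs_truncDiff_le hε (t - x))

lemma truncated_sub_cauchyTransform_re (hA : MeasurableSet A) (hfin : volume A < ⊤) {ε : ℝ}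
    (hε : 0 < ε) (x : ℝ) :
    (∫ t in {t : ℝ | ε < |t - x|}, A.indicator (fun _ => (1 : ℂ)) t / ((t : ℂ) - (x : ℂ))) -
      ((cauchyTransform A (x + ε * Complex.I)).re : ℂ) =
    ∫ t : ℝ, (truncDiff ε (t - x) : ℂ) * A.indicator (fun _ => (1 : ℂ)) t := by
  have hfm : IsFiniteMeasure (volume.restrict A) := ⟨by simpa using hfin⟩
  have hS : MeasurableSet {t : ℝ | ε < |t - x|} :=
    measurableSet_lt measurable_const (measurable_id.sub_const x).abs
  have e1 : ∫ t in {t : ℝ | ε < |t - x|},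
      A.indicator (fun _ => (1 : ℂ)) t / ((t : ℂ) - (x : ℂ)) =
      ((∫ t in A, if ε < |t - x| then (t - x)⁻¹ else 0 : ℝ) : ℂ) := by
    rw [← integral_complex_ofReal, ← integral_indicator hS, ← integral_indicator hA]
    congr 1 with t
    by_cases h1 : ε < |t - x| <;> by_cases h2 : t ∈ A <;> simp [indicator, h1, h2]
  have e2 : ∫ t : ℝ, (truncDiff ε (t - x) : ℂ) * A.indicator (fun _ => (1 : ℂ)) t =
      ((∫ t in A, truncDiff ε (t - x) : ℝ) : ℂ) := by
    rw [← integral_complex_ofReal, ← integral_indicator hA]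
    congr 1 with t
    by_cases h2 : t ∈ A <;> simp [indicator, h2]
  have e3 := cauchyTransform_re (A := A) hfin (z := x + ε * Complex.I) (by simpa using hε)
  have hi : Integrable (fun t => if ε < |t - x| then (t - x)⁻¹ else 0) (volume.restrict A) := by
    refine Integrable.of_bound (Measurable.ite hS (by fun_prop)
      measurable_const).aestronglyMeasurable ε⁻¹ (ae_of_all _ fun t => ?_)
    split_ifs with h
    · rw [norm_inv]
      exact inv_anti₀ hε h.le
    · simpa using hε.le
  have hi2 : Integrable (fun t => truncDiff ε (t - x)) (volume.restrict A) :=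
    (integrable_truncDiff hε x).restrict
  rw [e1, e2, e3, ← Complex.ofReal_sub]
  simp only [Complex.add_re, Complex.ofReal_re, Complex.mul_re, Complex.I_re, mul_zero,
    Complex.ofReal_im, Complex.I_im, mul_one, sub_self, add_zero, Complex.add_im, Complex.mul_im,
    zero_add]
  congr 1
  rw [sub_eq_iff_eq_add, ← sub_eq_iff_eq_add', ← integral_sub hi hi2]
  refine integral_congr_ae (ae_of_all _ fun t => ?_)
  simp [truncDiff]

/-- At Lebesgue points of `χ_A`, truncated Hilbert integrals and the real part of the Cauchy
transform are asymptotically equal. -/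
lemma tendsto_truncated_sub (hA : MeasurableSet A) (hfin : volume A < ⊤) {x : ℝ}
    (hx : Tendsto (fun y : ℝ => ∫⁻ t, ENNReal.ofReal (y / ((t - x) ^ 2 + y ^ 2)) *
      ‖A.indicator (fun _ => (1 : ℂ)) t - A.indicator (fun _ => (1 : ℂ)) x‖ₑ) (𝓝[>] 0) (𝓝 0)) :
    Tendsto (fun ε : ℝ => (∫ t in {t : ℝ | ε < |t - x|},
      A.indicator (fun _ => (1 : ℂ)) t / ((t : ℂ) - (x : ℂ))) -
      ((cauchyTransform A (x + ε * Complex.I)).re : ℂ)) (𝓝[>] 0) (𝓝 0) := by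
  refine tendsto_of_enorm_sub_le hx fun ε hε => ?_
  set g := A.indicator (fun _ => (1 : ℂ)) with hg
  rw [sub_zero, truncated_sub_cauchyTransform_re hA hfin hε]
  have hk : Integrable fun t : ℝ => (truncDiff ε (t - x) : ℂ) := (integrable_truncDiff hε x).ofReal
  have hk0 : ∫ t : ℝ, (truncDiff ε (t - x) : ℂ) * g x = 0 := by
    rw [integral_mul_const, integral_complex_ofReal, integral_truncDiff]
    simp
  have hi : Integrable fun t : ℝ => (truncDiff ε (t - x) : ℂ) * g t := by
    refine hk.mul_bdd (c := 1) (measurable_const.indicator hA).aestronglyMeasurable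
      (ae_of_all _ fun t => ?_)
    refine (norm_indicator_le_norm_self _ _).trans (by simp)
  have : ∫ t : ℝ, (truncDiff ε (t - x) : ℂ) * g t =
      ∫ t : ℝ, (truncDiff ε (t - x) : ℂ) * (g t - g x) := by
    simp_rw [mul_sub]
    rw [integral_sub hi (hk.mul_const _), hk0, sub_zero]
  rw [this]
  refine (enorm_integral_le_lintegral_enorm _).trans (lintegral_mono fun t => ?_)
  rw [enorm_mul]
  refine mul_le_mul_left ?_ _
  rw [← ofReal_norm, Complex.norm_real]
  exact ENNReal.ofReal_le_ofReal (abs_truncDiff_le hε _)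

/-- Almost everywhere boundary values: the Cauchy transform has radial limits `u + iπ` on `A`,
and `u / π` is the Hilbert transform. -/
lemma exists_ae_boundary (hA : MeasurableSet A) (hfin : volume A < ⊤) :
    ∃ u : ℝ → ℝ, Measurable u ∧ ∀ᵐ x : ℝ,
      hilbertIndicator A x = (Real.pi : ℂ)⁻¹ * u x ∧
      (x ∈ A → Tendsto (fun y : ℝ => cauchyTransform A (x + y * Complex.I)) (𝓝[>] 0)
        (𝓝 (u x + Real.pi * Complex.I))) := by
  obtain ⟨f, hfm, hf, hrep⟩ := exists_boundary_value (A := A) hfin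
  have hgm : Measurable (A.indicator (fun _ => (1 : ℂ))) := measurable_const.indicator hA
  have hg : MemLp (A.indicator (fun _ => (1 : ℂ))) 2 := memLp_indicator_const 2 hA 1 (Or.inr hfin.ne)
  have hpi : (Real.pi : ℂ) ≠ 0 := by exact_mod_cast Real.pi_ne_zero
  refine ⟨fun x => (f x).re, Complex.measurable_re.comp hfm, ?_⟩
  filter_upwards [ae_tendsto_lintegral_poisson hfm hf, ae_tendsto_lintegral_poisson hgm hg]
    with x hx1 hx2
  have hF : Tendsto (fun y : ℝ => cauchyTransform A (x + y * Complex.I)) (𝓝[>] 0) (𝓝 (f x)) := by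
    have := (tendsto_poisson_integral hf hx1).const_mul (Real.pi : ℂ)⁻¹
    rw [inv_mul_cancel_left₀ hpi] at this
    refine this.congr' ?_
    filter_upwards [self_mem_nhdsWithin] with y hy
    rw [hrep x y hy, inv_mul_cancel_left₀ hpi]
  refine ⟨?_, fun hxA => ?_⟩
  · have hre := (Complex.continuous_ofReal.tendsto _).comp ((Complex.continuous_re.tendsto _).comp hF)
    have hT := ((tendsto_truncated_sub hA hfin hx2).add hre).const_mul (Real.pi : ℂ)⁻¹
    simp only [Function.comp, sub_add_cancel, zero_add] at hT
    have hex : ∃ L : ℂ, Tendsto (fun ε : ℝ => (Real.pi : ℂ)⁻¹ *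
        ∫ t in {t : ℝ | ε < |t - x|}, A.indicator (fun _ => (1 : ℂ)) t / ((t : ℂ) - (x : ℂ)))
        (𝓝[>] 0) (𝓝 L) := ⟨_, hT⟩
    rw [hilbertIndicator, dif_pos hex]
    exact tendsto_nhds_unique hex.choose_spec hT
  · have him : (f x).im = Real.pi := by
      have h1 := (Complex.continuous_re.tendsto _).comp (tendsto_poisson_integral hg hx2)
      have h2 := (Complex.continuous_im.tendsto _).comp hF
      refine tendsto_nhds_unique h2 ?_
      have h3 : (Real.pi * A.indicator (fun _ => (1 : ℂ)) x : ℂ).re = Real.pi := by simp [hxA]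
      rw [h3] at h1
      refine h1.congr' ?_
      filter_upwards [self_mem_nhdsWithin] with y hy
      simp only [Function.comp]
      rw [cauchyTransform_line_im hfin hy, ← integral_indicator hA]
      rw [← Complex.ofReal_re (∫ t : ℝ, A.indicator _ t), ← integral_complex_ofReal]
      congr 2 with t
      by_cases h2 : t ∈ A <;> simp [indicator, h2]
    have : (((f x).re : ℝ) : ℂ) + Real.pi * Complex.I = f x := by
      rw [← him, Complex.re_add_im]
    rwa [this]
end

lemma one_add_exp_mem_slitPlane {w : ℂ} (hw : |w.im| < Real.pi) :
    1 + Complex.exp w ∈ Complex.slitPlane := by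
  rw [Complex.mem_slitPlane_iff]
  by_cases h : w.im = 0
  · left
    simp only [Complex.add_re, Complex.one_re, Complex.exp_re, h, Real.cos_zero]
    positivity
  · right
    simp only [Complex.add_im, Complex.one_im, Complex.exp_im, zero_add]
    refine mul_ne_zero (Real.exp_ne_zero _) fun h0 => h ?_
    exact (Real.sin_eq_zero_iff_of_lt_of_lt (abs_lt.1 hw).1 (abs_lt.1 hw).2).1 h0

/-- The angle of `1 + e^{v - s}`, where `v = σ Re w + i Im w`. -/
noncomputable def shiftedArg (σ s : ℝ) (w : ℂ) : ℝ :=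
  Complex.arg (1 + Complex.exp ⟨σ * w.re - s, w.im⟩)

lemma measurable_shiftedArg (σ s : ℝ) : Measurable (shiftedArg σ s) := by
  have h : Measurable fun w : ℂ => (⟨σ * w.re - s, w.im⟩ : ℂ) := by
    have : (fun w : ℂ => (⟨σ * w.re - s, w.im⟩ : ℂ)) =
        fun w : ℂ => ((σ * w.re - s : ℝ) : ℂ) + (w.im : ℂ) * Complex.I := by
      funext w
      exact Complex.mk_eq_add_mul_I _ _
    rw [this]
    fun_prop
  exact Complex.measurable_arg.comp ((Complex.measurable_exp.comp h).const_add 1)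

lemma shiftedArg_nonneg (σ s : ℝ) {w : ℂ} (h0 : 0 ≤ w.im) (h1 : w.im ≤ Real.pi) :
    0 ≤ shiftedArg σ s w := by
  rw [shiftedArg, Complex.arg_nonneg_iff]
  simp only [Complex.add_im, Complex.one_im, Complex.exp_im, zero_add]
  exact mul_nonneg (Real.exp_pos _).le (Real.sin_nonneg_of_nonneg_of_le_pi h0 h1)

lemma tendsto_shiftedArg {ι : Type*} {l : Filter ι} {w : ι → ℂ} {σ s u : ℝ}
    (hw : Tendsto w l (𝓝 (u + Real.pi * Complex.I))) (h0 : ∀ᶠ i in l, 0 ≤ (w i).im)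
    (h1 : ∀ᶠ i in l, (w i).im ≤ Real.pi) (hs : s < σ * u) :
    Tendsto (fun i => shiftedArg σ s (w i)) l (𝓝 Real.pi) := by
  have hre : Tendsto (fun i => (w i).re) l (𝓝 u) := by
    simpa [Function.comp_def] using (Complex.continuous_re.tendsto _).comp hw
  have him : Tendsto (fun i => (w i).im) l (𝓝 Real.pi) := by
    simpa [Function.comp_def] using (Complex.continuous_im.tendsto _).comp hw
  have hv : Tendsto (fun i => (⟨σ * (w i).re - s, (w i).im⟩ : ℂ)) l
      (𝓝 (((σ * u - s : ℝ) : ℂ) + Real.pi * Complex.I)) := by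
    simp_rw [Complex.mk_eq_add_mul_I]
    refine Tendsto.add ?_ (Tendsto.mul_const _ ?_)
    · exact (Complex.continuous_ofReal.tendsto _).comp ((hre.const_mul σ).sub_const s)
    · exact (Complex.continuous_ofReal.tendsto _).comp him
  have hE := ((Complex.continuous_exp.tendsto _).comp hv).const_add 1
  have hval : 1 + Complex.exp (((σ * u - s : ℝ) : ℂ) + Real.pi * Complex.I) =
      ((1 - Real.exp (σ * u - s) : ℝ) : ℂ) := by
    rw [Complex.exp_add, Complex.exp_pi_mul_I]
    push_cast
    ring
  rw [hval] at hE
  have hlt : 1 < Real.exp (σ * u - s) := by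
    rw [Real.one_lt_exp_iff]
    linarith
  refine (Complex.tendsto_arg_nhdsWithin_im_nonneg_of_re_neg_of_im_zero
    (z := ((1 - Real.exp (σ * u - s) : ℝ) : ℂ)) (by rw [Complex.ofReal_re]; linarith)
    (Complex.ofReal_im _)).comp (tendsto_nhdsWithin_iff.2 ⟨hE, ?_⟩)
  filter_upwards [h0, h1] with i hi0 hi1
  have : (1 + Complex.exp ⟨σ * (w i).re - s, (w i).im⟩).im =
      Real.exp (σ * (w i).re - s) * Real.sin (w i).im := by
    simp [Complex.exp_im]
  refine this.ge.trans' ?_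
  exact mul_nonneg (Real.exp_pos _).le (Real.sin_nonneg_of_nonneg_of_le_pi hi0 hi1)

lemma im_log_one_add_exp {σ : ℝ} (hσ : σ = 1 ∨ σ = -1) (s : ℝ) {w : ℂ}
    (hw : |w.im| < Real.pi) :
    (Complex.log (1 + Complex.exp (σ * w - s))).im = σ * shiftedArg σ s w := by
  rw [Complex.log_im, shiftedArg]
  rcases hσ with rfl | rfl
  · rw [one_mul]
    congr 3
    apply Complex.ext <;> simp
  · have h : 1 + Complex.exp (((-1 : ℝ) : ℂ) * w - s) =
        (starRingEnd ℂ) (1 + Complex.exp ⟨-1 * w.re - s, w.im⟩) := by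
      rw [map_add, map_one, ← Complex.exp_conj]
      congr 2
      apply Complex.ext <;> simp
    rw [h, Complex.arg_conj, if_neg]
    · ring
    · exact Complex.slitPlane_arg_ne_pi (one_add_exp_mem_slitPlane (by simpa using hw))

lemma exists_shiftedArg_expansion {σ : ℝ} (hσ : σ = 1 ∨ σ = -1) (s : ℝ) :
    ∃ R : ℂ → ℂ, DifferentiableOn ℂ R {w | |w.im| < Real.pi} ∧
      ∀ w : ℂ, |w.im| < Real.pi →
        shiftedArg σ s w = (1 + Real.exp s)⁻¹ * w.im + σ * (w ^ 2 * R w).im := by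
  have hσ2 : σ * σ = 1 := by rcases hσ with rfl | rfl <;> norm_num
  set G : ℂ → ℂ := fun w => Complex.log (1 + Complex.exp (σ * w - s)) with hG
  have hslit : ∀ w : ℂ, |w.im| < Real.pi → 1 + Complex.exp (σ * w - s) ∈ Complex.slitPlane := by
    intro w hw
    refine one_add_exp_mem_slitPlane ?_
    rcases hσ with rfl | rfl <;> simpa using hw
  have hderiv : ∀ w : ℂ, |w.im| < Real.pi → HasDerivAt G
      (Complex.exp (σ * w - s) * σ / (1 + Complex.exp (σ * w - s))) w := by
    intro w hw
    refine HasDerivAt.clog ?_ (hslit w hw)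
    have : HasDerivAt (fun w : ℂ => (σ : ℂ) * w - s) σ w := by
      simpa using ((hasDerivAt_id w).const_mul (σ : ℂ)).sub_const (s : ℂ)
    exact this.cexp.const_add 1
  have hopen : IsOpen {w : ℂ | |w.im| < Real.pi} :=
    isOpen_lt Complex.continuous_im.abs continuous_const
  have h0 : {w : ℂ | |w.im| < Real.pi} ∈ 𝓝 (0 : ℂ) :=
    hopen.mem_nhds (by simpa using Real.pi_pos)
  have hd : DifferentiableOn ℂ G {w | |w.im| < Real.pi} := fun w hw =>
    (hderiv w hw).differentiableAt.differentiableWithinAt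
  refine ⟨dslope (dslope G 0) 0, (Complex.differentiableOn_dslope h0).2
    ((Complex.differentiableOn_dslope h0).2 hd), fun w hw => ?_⟩
  have hG0 : (G 0).im = 0 := by
    have : G 0 = ((Real.log (1 + Real.exp (-s)) : ℝ) : ℂ) := by
      rw [Complex.ofReal_log (by positivity)]
      simp [hG]
    rw [this, Complex.ofReal_im]
  have hd0 : deriv G 0 = ((σ * (1 + Real.exp s)⁻¹ : ℝ) : ℂ) := by
    rw [(hderiv 0 (by simpa using Real.pi_pos)).deriv]
    have hexp : Complex.exp (σ * 0 - s) = ((Real.exp s)⁻¹ : ℝ) := by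
      rw [← Real.exp_neg]
      simp
    rw [hexp, ← Complex.ofReal_one, ← Complex.ofReal_add, ← Complex.ofReal_mul,
      ← Complex.ofReal_div]
    congr 1
    have := Real.exp_pos s
    field_simp
    ring
  have hexpand : G w = G 0 + w * (deriv G 0 + w * dslope (dslope G 0) 0 w) := by
    have e1 := sub_smul_dslope G 0 w
    have e2 := sub_smul_dslope (dslope G 0) 0 w
    rw [dslope_same] at e2
    simp only [sub_zero, smul_eq_mul] at e1 e2
    rw [e2, add_sub_cancel, e1, add_sub_cancel]
  have him := im_log_one_add_exp hσ s hw
  have : σ * (G w).im = shiftedArg σ s w := by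
    rw [hG, him, ← mul_assoc, hσ2, one_mul]
  rw [← this, hexpand, mul_add, ← mul_assoc w w, ← sq, Complex.add_im, Complex.add_im, hG0, hd0,
    mul_comm w, Complex.im_ofReal_mul]
  linear_combination ((1 + Real.exp s)⁻¹ * w.im) * hσ2

section
variable {A : Set ℝ}

lemma lintegral_shiftedArg_le (hfin : volume A < ⊤) {σ : ℝ} (hσ : σ = 1 ∨ σ = -1) (s : ℝ)
    {θ y : ℝ} (hθ0 : 0 ≤ θ) (hθ1 : θ < 1) (hy : 0 < y) :
    ∫⁻ x : ℝ, ENNReal.ofReal (shiftedArg σ s (θ * cauchyTransform A (x + y * Complex.I))) ≤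
      ENNReal.ofReal (Real.pi * (1 + Real.exp s)⁻¹) * volume A := by
  obtain ⟨R, hR, hexp⟩ := exists_shiftedArg_expansion hσ s
  obtain ⟨hi, hz⟩ := integral_cauchyTransform_sq_mul hfin hR hθ0 hθ1 hy
  have hF0 : ∀ x : ℝ, 0 ≤ (cauchyTransform A (x + y * Complex.I)).im := fun x =>
    cauchyTransform_im_nonneg hfin (by simpa using hy)
  have hF1 : ∀ x : ℝ, (cauchyTransform A (x + y * Complex.I)).im ≤ Real.pi := fun x =>
    cauchyTransform_im_le_pi hfin (by simpa using hy)
  have hlt : ∀ x : ℝ, θ * (cauchyTransform A (x + y * Complex.I)).im < Real.pi := fun x => by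
    nlinarith [hF0 x, hF1 x, Real.pi_pos]
  have heq : ∀ x : ℝ, shiftedArg σ s (θ * cauchyTransform A (x + y * Complex.I)) =
      θ * (1 + Real.exp s)⁻¹ * (cauchyTransform A (x + y * Complex.I)).im + σ * θ ^ 2 *
      (cauchyTransform A (x + y * Complex.I) ^ 2 *
        R (θ * cauchyTransform A (x + y * Complex.I))).im := by
    intro x
    rw [hexp, Complex.im_ofReal_mul, mul_pow, mul_assoc ((θ : ℂ) ^ 2), ← Complex.ofReal_pow,
      Complex.im_ofReal_mul]
    · ring
    · rw [Complex.im_ofReal_mul, abs_of_nonneg (mul_nonneg hθ0 (hF0 x))]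
      exact hlt x
  have i1 := (integrable_cauchyTransform_im hfin hy).const_mul (θ * (1 + Real.exp s)⁻¹)
  have i2 := hi.im.const_mul (σ * θ ^ 2)
  simp only [RCLike.im_eq_complex_im] at i2
  have hInt : ∫ x : ℝ, shiftedArg σ s (θ * cauchyTransform A (x + y * Complex.I)) =
      θ * (Real.pi * (1 + Real.exp s)⁻¹ * volume.real A) := by
    have hz' := integral_im hi
    simp only [RCLike.im_eq_complex_im] at hz'
    simp_rw [heq]
    rw [integral_add i1 i2, integral_const_mul, integral_const_mul,
      integral_cauchyTransform_im hfin hy, hz', hz, Complex.zero_im]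
    ring
  rw [← ofReal_integral_eq_lintegral_ofReal, hInt]
  · rw [← ENNReal.ofReal_toReal hfin.ne, ← ENNReal.ofReal_mul (by positivity)]
    refine ENNReal.ofReal_le_ofReal (mul_le_of_le_one_left ?_ hθ1.le)
    have := Real.pi_pos
    positivity
  · simp_rw [heq]
    exact i1.add i2
  · refine ae_of_all _ fun x => shiftedArg_nonneg _ _ ?_ ?_
    · rw [Complex.im_ofReal_mul]
      exact mul_nonneg hθ0 (hF0 x)
    · rw [Complex.im_ofReal_mul]
      exact (hlt x).le

lemma volume_superlevel_le (hA : MeasurableSet A) (hfin : volume A < ⊤) {u : ℝ → ℝ}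
    (hu : Measurable u)
    (hlim : ∀ᵐ x : ℝ, x ∈ A → Tendsto (fun y : ℝ => cauchyTransform A (x + y * Complex.I))
      (𝓝[>] 0) (𝓝 (u x + Real.pi * Complex.I)))
    {σ : ℝ} (hσ : σ = 1 ∨ σ = -1) (s : ℝ) :
    volume {x ∈ A | s < σ * u x} ≤ ENNReal.ofReal (1 + Real.exp s)⁻¹ * volume A := by
  set S := {x ∈ A | s < σ * u x} with hS
  have hSm : MeasurableSet S := hA.inter (measurableSet_lt measurable_const (hu.const_mul σ))
  set θ : ℕ → ℝ := fun n => 1 - 1 / ((n : ℝ) + 1) with hθ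
  set y : ℕ → ℝ := fun n => 1 / ((n : ℝ) + 1) with hy
  have hy0 : ∀ n, 0 < y n := fun n => by positivity
  have hθ0 : ∀ n, 0 ≤ θ n := fun n => by
    rw [hθ, sub_nonneg, div_le_one (by positivity)]
    linarith [n.cast_nonneg (α := ℝ)]
  have hθ1 : ∀ n, θ n < 1 := fun n => sub_lt_self _ (hy0 n)
  have hyt : Tendsto y atTop (𝓝[>] 0) := tendsto_nhdsWithin_iff.2
    ⟨tendsto_one_div_add_atTop_nhds_zero_nat, .of_forall hy0⟩
  have hθt : Tendsto θ atTop (𝓝 1) := by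
    simpa [hθ] using tendsto_one_div_add_atTop_nhds_zero_nat (𝕜 := ℝ).const_sub (1 : ℝ)
  set h : ℕ → ℝ → ℝ≥0∞ := fun n x =>
    ENNReal.ofReal (shiftedArg σ s (θ n * cauchyTransform A (x + y n * Complex.I))) with hh
  have hmeas : ∀ n, Measurable (h n) := fun n =>
    ((measurable_shiftedArg σ s).comp
      ((continuous_cauchyTransform_line hfin (hy0 n)).measurable.const_mul _)).ennreal_ofReal
  have hlow : ∫⁻ x, S.indicator (fun _ => ENNReal.ofReal Real.pi) x ≤
      ∫⁻ x, liminf (fun n => h n x) atTop := by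
    refine lintegral_mono_ae ?_
    filter_upwards [hlim] with x hx
    by_cases hxS : x ∈ S
    · rw [indicator_of_mem hxS]
      have hF := (hx hxS.1).comp hyt
      have hw : Tendsto (fun n => (θ n : ℂ) * cauchyTransform A (x + y n * Complex.I)) atTop
          (𝓝 (u x + Real.pi * Complex.I)) := by
        simpa using ((Complex.continuous_ofReal.tendsto _).comp hθt).mul hF
      have hF0 : ∀ n, 0 ≤ (cauchyTransform A (x + y n * Complex.I)).im := fun n =>
        cauchyTransform_im_nonneg hfin (by simpa using hy0 n)
      have hF1 : ∀ n, (cauchyTransform A (x + y n * Complex.I)).im ≤ Real.pi := fun n =>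
        cauchyTransform_im_le_pi hfin (by simpa using hy0 n)
      have := (tendsto_shiftedArg (σ := σ) (s := s) hw
        (.of_forall fun n => by
          rw [Complex.im_ofReal_mul]
          exact mul_nonneg (hθ0 n) (hF0 n))
        (.of_forall fun n => by
          rw [Complex.im_ofReal_mul]
          exact (mul_le_of_le_one_left (hF0 n) (hθ1 n).le).trans (hF1 n)) hxS.2)
      exact ((ENNReal.continuous_ofReal.tendsto _).comp this).liminf_eq.ge
    · rw [indicator_of_notMem hxS]
      exact zero_le
  have hup : ∫⁻ x, liminf (fun n => h n x) atTop ≤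
      ENNReal.ofReal (Real.pi * (1 + Real.exp s)⁻¹) * volume A := by
    refine (lintegral_liminf_le hmeas).trans ?_
    refine liminf_le_of_le (by isBoundedDefault) fun b hb => ?_
    obtain ⟨n, hn⟩ := hb.exists
    exact hn.trans (lintegral_shiftedArg_le hfin hσ s (hθ0 n) (hθ1 n) (hy0 n))
  have := hlow.trans hup
  rw [lintegral_indicator_const hSm, ENNReal.ofReal_mul Real.pi_pos.le, mul_assoc] at this
  exact (ENNReal.mul_le_mul_iff_right (by simpa using Real.pi_pos) ENNReal.ofReal_ne_top).1 this

lemma volume_superlevel (hA : MeasurableSet A) (hfin : volume A < ⊤) {u : ℝ → ℝ}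
    (hu : Measurable u)
    (hlim : ∀ᵐ x : ℝ, x ∈ A → Tendsto (fun y : ℝ => cauchyTransform A (x + y * Complex.I))
      (𝓝[>] 0) (𝓝 (u x + Real.pi * Complex.I)))
    {σ : ℝ} (hσ : σ = 1 ∨ σ = -1) (s : ℝ) :
    volume {x ∈ A | s < σ * u x} = ENNReal.ofReal (1 + Real.exp s)⁻¹ * volume A := by
  refine le_antisymm (volume_superlevel_le hA hfin hu hlim hσ s) ?_
  have hσ' : -σ = 1 ∨ -σ = -1 := by
    rcases hσ with rfl | rfl <;> norm_num
  have hlow : ∀ s' : ℝ, s < s' →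
      ENNReal.ofReal (1 + Real.exp s')⁻¹ * volume A ≤ volume {x ∈ A | s < σ * u x} := by
    intro s' hs
    have h1 := volume_superlevel_le hA hfin hu hlim hσ' (-s')
    have h2 : volume A ≤ volume {x ∈ A | s < σ * u x} + volume {x ∈ A | -s' < -σ * u x} := by
      refine (measure_mono fun x hx => ?_).trans (measure_union_le _ _)
      rcases lt_or_ge s (σ * u x) with h | h
      · exact Or.inl ⟨hx, h⟩
      · exact Or.inr ⟨hx, by linarith⟩
    have h3 : ENNReal.ofReal (1 + Real.exp s')⁻¹ * volume A +
        ENNReal.ofReal (1 + Real.exp (-s'))⁻¹ * volume A = volume A := by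
      rw [← add_mul, ← ENNReal.ofReal_add (by positivity) (by positivity)]
      have : (1 + Real.exp s')⁻¹ + (1 + Real.exp (-s'))⁻¹ = 1 := by
        rw [Real.exp_neg]
        have := Real.exp_pos s'
        field_simp
        ring
      rw [this, ENNReal.ofReal_one, one_mul]
    refine (ENNReal.add_le_add_iff_right
      (ENNReal.mul_ne_top (ENNReal.ofReal_ne_top (r := (1 + Real.exp (-s'))⁻¹)) hfin.ne)).1 ?_
    rw [h3]
    exact h2.trans (by gcongr)
  have hc : Tendsto (fun s' : ℝ => ENNReal.ofReal (1 + Real.exp s')⁻¹ * volume A) (𝓝[>] s)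
      (𝓝 (ENNReal.ofReal (1 + Real.exp s)⁻¹ * volume A)) := by
    refine ENNReal.Tendsto.mul_const ?_ (Or.inr hfin.ne)
    refine (ENNReal.continuous_ofReal.tendsto _).comp (Tendsto.mono_left ?_ nhdsWithin_le_nhds)
    exact ((Real.continuous_exp.tendsto s).const_add 1).inv₀ (by positivity)
  refine le_of_tendsto hc ?_
  filter_upwards [self_mem_nhdsWithin] with s' hs
  exact hlow s' hs
end

/-- Stein–Weiss/Laeng: for measurable `A ⊆ ℝ` with `m(A) < ∞` and `λ > 0`,
`m {x ∈ A : |H(χ_A)(x)| > λ} = 2 m(A) / (e^{πλ} + 1)`. -/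
theorem stmt6 (A : Set ℝ) (hA : MeasurableSet A) (hfin : volume A < ⊤)
    (lam : ℝ) (hlam : 0 < lam) :
    volume {x ∈ A | lam < ‖hilbertIndicator A x‖} =
      ENNReal.ofReal (2 / (Real.exp (Real.pi * lam) + 1)) * volume A := by
  obtain ⟨u, hu, hae⟩ := exists_ae_boundary hA hfin
  have hlim := hae.mono fun x hx => hx.2
  have hpos := volume_superlevel hA hfin hu hlim (Or.inl rfl) (Real.pi * lam)
  have hneg := volume_superlevel hA hfin hu hlim (Or.inr rfl) (Real.pi * lam)
  have hpl : 0 < Real.pi * lam := mul_pos Real.pi_pos hlam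
  have heq : ({x ∈ A | lam < ‖hilbertIndicator A x‖} : Set ℝ) =ᵐ[volume]
      ({x ∈ A | Real.pi * lam < 1 * u x} ∪ {x ∈ A | Real.pi * lam < -1 * u x} : Set ℝ) := by
    refine eventuallyEq_set.2 (hae.mono fun x hx => ?_)
    have hn : ‖hilbertIndicator A x‖ = |u x| / Real.pi := by
      rw [hx.1, norm_mul, norm_inv, Complex.norm_real, Complex.norm_real,
        Real.norm_of_nonneg Real.pi_pos.le, Real.norm_eq_abs, inv_mul_eq_div]
    simp only [Set.mem_union, Set.mem_ofPred_eq, hn, lt_div_iff₀ Real.pi_pos, mul_comm lam,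
      lt_abs, one_mul, neg_mul, ← and_or_left]
  have hdisj : Disjoint {x ∈ A | Real.pi * lam < 1 * u x} {x ∈ A | Real.pi * lam < -1 * u x} :=
    Set.disjoint_left.2 fun x h1 h2 => by linarith [h1.2, h2.2]
  rw [measure_congr heq, measure_union hdisj
    (hA.inter (measurableSet_lt measurable_const (hu.const_mul _))), hpos, hneg, ← add_mul,
    ← ENNReal.ofReal_add (by positivity) (by positivity)]
  congr 2
  ring
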